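/- arXiv:1510.04926 — 2 statements merged into one kernel-verified Lean document; each statement's English description precedes it below -/
import Mathlib

section
/- (Interior estimate, variable coefficients.) Let n ≥ 3 and let L = Σ a_{ij}(x) ∂ᵢ∂ⱼ be uniformly elliptic with symmetric coefficients that are Lipschitz continuous on I(2ρ) with Lipschitz constants bounded by A. Let ω be an oscillation function satisfying ∫₀^R ω(r)/r dr < ∞, lim_{r→0} ω(r)/r = +∞, ω(k₁' r) ≤ c₁ ω(r) near 0 for some k₁' > 1, c₁ > 0, B(r) = ( r ∫_r^R ω(s)/s² ds )/( ∫₀^r ω(s)/s ds ) ≤ C₂ near 0, and additionally ω(r) ≤ k₁ ĥ(r) near 0 for some constant k₁ > 0, where ĥ(r) = ∫₀^r ω(s)/s ds. Then there exist constants C, k₁ > 0 such that for every ρ with 0 < ρ ≤ 1/(2 C k₁) and every u twice continuously differentiable on I(2ρ) with Lu ∈ D_ω(I(2ρ)), the second derivatives of u belong to D_{ĥ}(I(ρ)) and [∇²u]_{ĥ; ρ} ≤ C [Lu]_{ω; 2ρ} + (C/ρ³) ‖u‖_{C²(I(2ρ))}. -/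
open Set Metric MeasureTheory Filter Topology

/-- The oscillation `ω_f(r)` of `f` over `K` at scale `r`. -/
noncomputable def oscf {n : ℕ} (K : Set (EuclideanSpace ℝ (Fin n)))
    (f : EuclideanSpace ℝ (Fin n) → ℝ) (r : ℝ) : ℝ :=
  sSup {d : ℝ | ∃ x ∈ K, ∃ y ∈ K, 0 < dist x y ∧ dist x y ≤ r ∧ d = |f x - f y|}

/-- The set of quotients `ω_f(r)/ω(r)`, `0 < r < R`, whose supremum is the seminorm `[f]_ω`. -/
def semiSet {n : ℕ} (K : Set (EuclideanSpace ℝ (Fin n))) (ω : ℝ → ℝ) (R : ℝ)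
    (f : EuclideanSpace ℝ (Fin n) → ℝ) : Set ℝ :=
  {c : ℝ | ∃ r ∈ Set.Ioo (0 : ℝ) R, c = oscf K f r / ω r}

/-- The seminorm `[f]_ω = sup_{0<r<R} ω_f(r)/ω(r)`. -/
noncomputable def domSemi {n : ℕ} (K : Set (EuclideanSpace ℝ (Fin n))) (ω : ℝ → ℝ) (R : ℝ)
    (f : EuclideanSpace ℝ (Fin n) → ℝ) : ℝ :=
  sSup (semiSet K ω R f)

/-- The sup norm `‖f‖` on `K`. -/
noncomputable def supNorm {n : ℕ} (K : Set (EuclideanSpace ℝ (Fin n)))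
    (f : EuclideanSpace ℝ (Fin n) → ℝ) : ℝ :=
  sSup {d : ℝ | ∃ x ∈ K, d = |f x|}

/-- Membership in the space `D_ω(K)`: `f` is continuous on `K` and `[f]_ω < ∞`. -/
def MemD {n : ℕ} (K : Set (EuclideanSpace ℝ (Fin n))) (ω : ℝ → ℝ) (R : ℝ)
    (f : EuclideanSpace ℝ (Fin n) → ℝ) : Prop :=
  ContinuousOn f K ∧ BddAbove (semiSet K ω R f)

/-- The norm `‖f‖_ω = [f]_ω + ‖f‖` on `D_ω(K)`. -/
noncomputable def domNorm {n : ℕ} (K : Set (EuclideanSpace ℝ (Fin n))) (ω : ℝ → ℝ) (R : ℝ)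
    (f : EuclideanSpace ℝ (Fin n) → ℝ) : ℝ :=
  domSemi K ω R f + supNorm K f

/-- An oscillation function on `[0,R]`: continuous, non-decreasing, `ω(0)=0`, `ω(r)>0` for `r>0`. -/
structure IsOsc (ω : ℝ → ℝ) (R : ℝ) : Prop where
  cont : ContinuousOn ω (Set.Icc 0 R)
  mono : MonotoneOn ω (Set.Icc 0 R)
  zero : ω 0 = 0
  pos : ∀ r : ℝ, 0 < r → r ≤ R → 0 < ω r

/-- The second partial derivative `∂ᵢ∂ⱼ f` at `x`. -/
noncomputable def pd2 {n : ℕ} (f : EuclideanSpace ℝ (Fin n) → ℝ) (i j : Fin n)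
    (x : EuclideanSpace ℝ (Fin n)) : ℝ :=
  fderiv ℝ (fun y => fderiv ℝ f y (EuclideanSpace.single j 1)) x (EuclideanSpace.single i 1)

/-- The `C²` norm on `K`: the supremum of `|u| + |∇u| + |∇²u|`. -/
noncomputable def c2norm {n : ℕ} (K : Set (EuclideanSpace ℝ (Fin n)))
    (u : EuclideanSpace ℝ (Fin n) → ℝ) : ℝ :=
  sSup {c : ℝ | ∃ x ∈ K, c = |u x| + ‖fderiv ℝ u x‖ + ‖fderiv ℝ (fderiv ℝ u) x‖}

/-- The partial derivative `∂ₖ f`. -/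
noncomputable def pd1 {n : ℕ} (f : EuclideanSpace ℝ (Fin n) → ℝ) (k : Fin n)
    (x : EuclideanSpace ℝ (Fin n)) : ℝ :=
  fderiv ℝ f x (EuclideanSpace.single k 1)
section PartialDerivatives

variable {n : ℕ} {f g : EuclideanSpace ℝ (Fin n) → ℝ}

lemma pd2_eq_pd1_pd1 (f : EuclideanSpace ℝ (Fin n) → ℝ) (i j : Fin n) :
    pd2 f i j = pd1 (pd1 f j) i := rfl

lemma contDiff_pd1 {m : ℕ} (hf : ContDiff ℝ (m + 1 : ℕ) f) (k : Fin n) :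
    ContDiff ℝ m (pd1 f k) :=
  (hf.fderiv_right (by norm_cast)).clm_apply contDiff_const

lemma hasCompactSupport_pd1 (hf : HasCompactSupport f) (k : Fin n) :
    HasCompactSupport (pd1 f k) := by
  have := hf.fderiv (𝕜 := ℝ)
  exact this.comp_left (g := fun L : EuclideanSpace ℝ (Fin n) →L[ℝ] ℝ =>
    L (EuclideanSpace.single k 1)) rfl

lemma pd2_eq_fderiv_fderiv {x : EuclideanSpace ℝ (Fin n)}
    (hd : DifferentiableAt ℝ (fderiv ℝ f) x) (i j : Fin n) :
    pd2 f i j x =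
      fderiv ℝ (fderiv ℝ f) x (EuclideanSpace.single i 1) (EuclideanSpace.single j 1) := by
  have := (hd.hasFDerivAt.clm_apply
    (hasFDerivAt_const (EuclideanSpace.single j (1 : ℝ)) x)).fderiv
  unfold pd2
  rw [this]
  simp

lemma pd1_comm (hf : ContDiff ℝ 2 f) (i j : Fin n) :
    pd1 (pd1 f i) j = pd1 (pd1 f j) i := by
  ext x
  have hd : DifferentiableAt ℝ (fderiv ℝ f) x :=
    ((hf.fderiv_right (m := 1) (by norm_num)).differentiable (by norm_num)) x
  rw [← pd2_eq_pd1_pd1, ← pd2_eq_pd1_pd1, pd2_eq_fderiv_fderiv hd, pd2_eq_fderiv_fderiv hd]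
  exact (hf.contDiffAt.isSymmSndFDerivAt (by simp)) _ _

lemma pd1_mul (hf : Differentiable ℝ f) (hg : Differentiable ℝ g) (k : Fin n)
    (x : EuclideanSpace ℝ (Fin n)) :
    pd1 (fun y => f y * g y) k x = pd1 f k x * g x + f x * pd1 g k x := by
  simp only [pd1]
  have := ((hf x).hasFDerivAt.mul (hg x).hasFDerivAt).fderiv
  erw [this]
  simp
  ring

lemma pd1_comp_add_smul (hf : Differentiable ℝ f) (z : EuclideanSpace ℝ (Fin n)) (τ : ℝ)
    (k : Fin n) (w : EuclideanSpace ℝ (Fin n)) :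
    pd1 (fun y => f (z + τ • y)) k w = τ * pd1 f k (z + τ • w) := by
  have h1 : HasFDerivAt (fun y : EuclideanSpace ℝ (Fin n) => z + τ • y)
      (τ • ContinuousLinearMap.id ℝ _) w := ((hasFDerivAt_id w).const_smul τ).const_add z
  have := ((hf (z + τ • w)).hasFDerivAt.comp w h1).fderiv
  simp only [pd1]
  erw [this]
  simp

lemma fderiv_eq_sum_pd1 (f : EuclideanSpace ℝ (Fin n) → ℝ) (x w : EuclideanSpace ℝ (Fin n)) :
    fderiv ℝ f x w = ∑ k, w k * pd1 f k x := by
  conv_lhs => rw [← (EuclideanSpace.basisFun (Fin n) ℝ).sum_repr w]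
  simp [pd1]

lemma integral_pd1_mul (hf : ContDiff ℝ 1 f) (hc : HasCompactSupport f) (hg : ContDiff ℝ 1 g)
    (k : Fin n) : ∫ w, pd1 f k w * g w = -∫ w, f w * pd1 g k w := by
  have cf : Continuous (pd1 f k) := (contDiff_pd1 (m := 0) (by simpa using hf) k).continuous
  have cg : Continuous (pd1 g k) := (contDiff_pd1 (m := 0) (by simpa using hg) k).continuous
  have := integral_mul_fderiv_eq_neg_fderiv_mul_of_integrable (μ := volume) (f := f) (g := g)
    (v := EuclideanSpace.single k (1 : ℝ)) (𝕜 := ℝ)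
    ((cf.mul hg.continuous).integrable_of_hasCompactSupport ((hasCompactSupport_pd1 hc k).mul_right))
    ((hf.continuous.mul cg).integrable_of_hasCompactSupport hc.mul_right)
    ((hf.continuous.mul hg.continuous).integrable_of_hasCompactSupport hc.mul_right)
    (fun x _ => (hf.differentiable (by norm_num)) x) (fun x _ => (hg.differentiable (by norm_num)) x)
  simp only [pd1]
  rw [this, neg_neg]

lemma integral_pd1 (hf : ContDiff ℝ 1 f) (hc : HasCompactSupport f) (k : Fin n) :
    ∫ w, pd1 f k w = 0 := by
  have := integral_pd1_mul hf hc (g := fun _ => 1) contDiff_const k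
  simpa [pd1] using this

lemma integral_pd1_mul_pd1_swap (hf : ContDiff ℝ 2 f) (hc : HasCompactSupport f)
    (hg : ContDiff ℝ 1 g) (k l : Fin n) :
    ∫ w, pd1 f l w * pd1 g k w = ∫ w, pd1 f k w * pd1 g l w := by
  have h1 := integral_pd1_mul (contDiff_pd1 (m := 1) hf l) (hasCompactSupport_pd1 hc l) hg k
  have h2 := integral_pd1_mul (contDiff_pd1 (m := 1) hf k) (hasCompactSupport_pd1 hc k) hg l
  rw [pd1_comm hf l k, h2] at h1
  exact (neg_injective h1).symm

lemma hasDerivAt_integral_mul_comp_add_smul (hf : Continuous f) (hc : HasCompactSupport f)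
    (hg : ContDiff ℝ 1 g) (hgc : HasCompactSupport g) (z : EuclideanSpace ℝ (Fin n)) (τ : ℝ) :
    HasDerivAt (fun σ : ℝ => ∫ w, f w * g (z + σ • w))
      (∫ w, f w * fderiv ℝ g (z + τ • w) w) τ := by
  obtain ⟨D, hD⟩ := (hgc.fderiv (𝕜 := ℝ)).exists_bound_of_continuous
    (hg.continuous_fderiv (by norm_num))
  have hcd : Continuous (fderiv ℝ g) := hg.continuous_fderiv (by norm_num)
  refine (hasDerivAt_integral_of_dominated_loc_of_deriv_le (s := univ) (μ := volume)
    (F := fun (σ : ℝ) w => f w * g (z + σ • w))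
    (F' := fun (σ : ℝ) w => f w * fderiv ℝ g (z + σ • w) w)
    (bound := fun w => |f w| * (D * ‖w‖)) univ_mem ?_ ?_ ?_ ?_ ?_ ?_).2
  · refine Eventually.of_forall fun σ => Continuous.aestronglyMeasurable ?_
    have := hg.continuous
    fun_prop
  · refine Continuous.integrable_of_hasCompactSupport ?_ hc.mul_right
    have := hg.continuous
    fun_prop
  · refine Continuous.aestronglyMeasurable ?_
    fun_prop
  · refine Eventually.of_forall fun w σ _ => ?_
    rw [norm_mul, Real.norm_eq_abs]
    gcongr
    exact (ContinuousLinearMap.le_opNorm _ _).trans (by gcongr; exact hD _)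
  · refine Continuous.integrable_of_hasCompactSupport (by fun_prop) ?_
    exact HasCompactSupport.mul_right (hc.comp_left (g := fun t : ℝ => |t|) abs_zero)
  · refine Eventually.of_forall fun w σ _ => ?_
    have h1 : HasDerivAt (fun σ : ℝ => z + σ • w) w σ := by
      simpa using ((hasDerivAt_id σ).smul_const w).const_add z
    exact (((hg.differentiable (by norm_num)) _).hasFDerivAt.comp_hasDerivAt σ h1).const_mul (f w)

lemma integral_mul_pd2_comp_add_smul {φ u : EuclideanSpace ℝ (Fin n) → ℝ}
    (hφ : ContDiff ℝ 1 φ) (hφc : HasCompactSupport φ) (hu : ContDiff ℝ 2 u) (i j : Fin n)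
    (z : EuclideanSpace ℝ (Fin n)) {σ : ℝ} (hσ : σ ≠ 0) :
    ∫ w, φ w * pd2 u i j (z + σ • w) = -(σ⁻¹ * ∫ w, pd1 φ i w * pd1 u j (z + σ • w)) := by
  have hV : ContDiff ℝ 1 (pd1 u j) := contDiff_pd1 (m := 1) hu j
  have hW : ContDiff ℝ 1 (fun w => pd1 u j (z + σ • w)) :=
    hV.comp (contDiff_const.add (contDiff_id.const_smul σ))
  rw [integral_pd1_mul hφ hφc hW i, mul_neg, neg_neg, ← integral_const_mul]
  congr 1; ext w
  rw [pd1_comp_add_smul (hV.differentiable (by norm_num)), pd2_eq_pd1_pd1]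
  field_simp

/-- If `a ∇ψ = w φ` with `∇ψ = κ`, then averaging `∂ᵢ∂ⱼu` against the dilates of `φ` gives a
function of the scale whose derivative only sees `∑ aₖₗ ∂ₖ∂ₗu`. -/
lemma hasDerivAt_average_pd2 {φ u : EuclideanSpace ℝ (Fin n) → ℝ}
    {κ : Fin n → EuclideanSpace ℝ (Fin n) → ℝ} {a : Fin n → Fin n → ℝ}
    (hφ : ContDiff ℝ 1 φ) (hφc : HasCompactSupport φ)
    (hκ : ∀ i, ContDiff ℝ 2 (κ i)) (hκc : ∀ i, HasCompactSupport (κ i))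
    (ha : ∀ k w, ∑ l, a k l * κ l w = w k * φ w) (hs : ∀ i l, pd1 (κ l) i = pd1 (κ i) l)
    (hu : ContDiff ℝ 2 u) (huc : HasCompactSupport u) (i j : Fin n)
    (z : EuclideanSpace ℝ (Fin n)) {τ : ℝ} (hτ : 0 < τ) :
    HasDerivAt (fun σ : ℝ => ∫ w, φ w * pd2 u i j (z + σ • w))
      (-(τ⁻¹ * ∫ w, pd1 (κ i) j w * ∑ k, ∑ l, a k l * pd2 u k l (z + τ • w))) τ := by
  have hV : ∀ j, ContDiff ℝ 1 (pd1 u j) := contDiff_pd1 (m := 1) hu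
  have hVd : ∀ j, Differentiable ℝ (pd1 u j) := fun j => (hV j).differentiable (by norm_num)
  have hVc := hasCompactSupport_pd1 huc
  have hW : ∀ (j) (σ : ℝ), ContDiff ℝ 1 (fun w => pd1 u j (z + σ • w)) := fun j σ =>
    (hV j).comp (contDiff_const.add (contDiff_id.const_smul σ))
  have cφ : Continuous (pd1 φ i) := (contDiff_pd1 (m := 0) (by simpa using hφ) i).continuous
  have cW : ∀ (j k) (σ : ℝ), Continuous (pd1 (fun w => pd1 u j (z + σ • w)) k) := fun j k σ =>
    (contDiff_pd1 (m := 0) (by simpa using hW j σ) k).continuous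
  have cκ : ∀ i l, Continuous (pd1 (κ i) l) := fun i l =>
    (contDiff_pd1 (m := 1) (hκ i) l).continuous
  have hφd := hφ.differentiable (by norm_num)
  have hcoord : ∀ k : Fin n, ContDiff ℝ 1 (fun w : EuclideanSpace ℝ (Fin n) => w k) := by
    intro k; fun_prop
  have hpcoord : ∀ k w, pd1 (fun w : EuclideanSpace ℝ (Fin n) => w k) i w
      = if k = i then 1 else 0 := by
    intro k w
    have := (EuclideanSpace.proj (𝕜 := ℝ) k : EuclideanSpace ℝ (Fin n) →L[ℝ] ℝ).fderiv (x := w)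
    simp only [pd1]
    erw [this]
    simp
  have hJ := hasDerivAt_integral_mul_comp_add_smul cφ (hasCompactSupport_pd1 hφc i)
    (hV j) (hVc j) z τ
  set J : ℝ → ℝ := fun σ => ∫ w, pd1 φ i w * pd1 u j (z + σ • w) with hJdef
  have hF : ∀ σ : ℝ, σ ≠ 0 → ∫ w, φ w * pd2 u i j (z + σ • w) = -(σ⁻¹ * J σ) := fun σ hσ =>
    integral_mul_pd2_comp_add_smul hφ hφc hu i j z hσ
  set S : ℝ := ∑ k, ∫ w, pd1 (fun w => w k * φ w) i w * pd1 (fun w => pd1 u j (z + τ • w)) k w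
    with hS
  have hJ' : ∫ w, pd1 φ i w * fderiv ℝ (pd1 u j) (z + τ • w) w = τ⁻¹ * (S + J τ) := by
    have e1 : ∀ w, pd1 φ i w * fderiv ℝ (pd1 u j) (z + τ • w) w =
        τ⁻¹ * (∑ k, pd1 (fun w => w k * φ w) i w * pd1 (fun w => pd1 u j (z + τ • w)) k w
          - φ w * pd1 (fun w => pd1 u j (z + τ • w)) i w) := by
      intro w
      simp_rw [pd1_mul ((hcoord _).differentiable (by norm_num)) hφd, hpcoord,
        pd1_comp_add_smul (hVd j), fderiv_eq_sum_pd1, add_mul, Finset.sum_add_distrib]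
      simp only [ite_mul, one_mul, zero_mul, Finset.sum_ite_eq', Finset.mem_univ, if_true]
      rw [add_sub_cancel_left, Finset.mul_sum, Finset.mul_sum]
      refine Finset.sum_congr rfl fun k _ => ?_
      field_simp
    have cp : ∀ k, Continuous (pd1 (fun w => w k * φ w) i) := fun k =>
      (contDiff_pd1 (m := 0) (by simpa using (hcoord k).mul hφ) i).continuous
    have hcp : ∀ k, HasCompactSupport (pd1 (fun w => w k * φ w) i) := fun k =>
      hasCompactSupport_pd1 hφc.mul_left i
    have I1 : ∀ k, Integrable (fun w => pd1 (fun w => w k * φ w) i w *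
        pd1 (fun w => pd1 u j (z + τ • w)) k w) := fun k =>
      ((cp k).mul (cW j k τ)).integrable_of_hasCompactSupport (hcp k).mul_right
    have I2 : Integrable (fun w => φ w * pd1 (fun w => pd1 u j (z + τ • w)) i w) :=
      (hφ.continuous.mul (cW j i τ)).integrable_of_hasCompactSupport hφc.mul_right
    simp_rw [e1]
    rw [integral_const_mul, integral_sub (integrable_finsetSum _ fun k _ => I1 k) I2,
      integral_finsetSum _ fun k _ => I1 k, ← neg_eq_iff_eq_neg.mpr
        (integral_pd1_mul hφ hφc (hW j τ) i), sub_neg_eq_add]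
  have hSval : S = τ * ∫ w, pd1 (κ i) j w * ∑ k, ∑ l, a k l * pd2 u k l (z + τ • w) := by
    have e2 : ∀ k w, pd1 (fun w => w k * φ w) i w = ∑ l, a k l * pd1 (κ i) l w := by
      intro k w
      have hfun : (fun w : EuclideanSpace ℝ (Fin n) => w k * φ w) =
          fun w => ∑ l, a k l * κ l w := by ext w; rw [ha]
      have hd : HasFDerivAt (fun w => ∑ l, a k l * κ l w) (∑ l, a k l • fderiv ℝ (κ l) w) w :=
        HasFDerivAt.fun_sum fun l _ =>
          ((((hκ l).differentiable (by norm_num)) w).hasFDerivAt.const_mul (a k l))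
      rw [hfun]
      simp only [pd1]
      rw [hd.fderiv]
      simp only [_root_.sum_apply, _root_.smul_apply,
        smul_eq_mul]
      refine Finset.sum_congr rfl fun l _ => ?_
      have := congrFun (hs i l) w
      simp only [pd1] at this
      rw [this]
    have e3 : ∀ k l, ∫ w, pd1 (κ i) l w * pd1 (fun w => pd1 u j (z + τ • w)) k w =
        τ * ∫ w, pd1 (κ i) j w * pd2 u k l (z + τ • w) := by
      intro k l
      have e4 : pd1 (fun w => pd1 u j (z + τ • w)) k = pd1 (fun w => pd1 u k (z + τ • w)) j := by
        ext w
        rw [pd1_comp_add_smul (hVd j), pd1_comp_add_smul (hVd k), pd1_comm hu]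
      rw [e4, integral_pd1_mul_pd1_swap (hκ i) (hκc i) (hW k τ), ← integral_const_mul]
      congr 1; ext w
      rw [pd1_comp_add_smul (hVd k), pd2_eq_pd1_pd1, pd1_comm hu k l]
      ring
    have cp2 : ∀ k l, Continuous (pd2 u k l) := fun k l =>
      (contDiff_pd1 (f := pd1 u l) (m := 0) (by simpa using hV l) k).continuous
    have I3 : ∀ k l, Integrable (fun w => pd1 (κ i) l w *
        pd1 (fun w => pd1 u j (z + τ • w)) k w) := fun k l =>
      ((cκ i l).mul (cW j k τ)).integrable_of_hasCompactSupport
        (hasCompactSupport_pd1 (hκc i) l).mul_right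
    have I4 : ∀ k l, Integrable (fun w => pd1 (κ i) j w * pd2 u k l (z + τ • w)) := fun k l =>
      ((cκ i j).mul ((cp2 k l).comp (by fun_prop))).integrable_of_hasCompactSupport
        (hasCompactSupport_pd1 (hκc i) j).mul_right
    rw [hS]
    simp_rw [e2, Finset.sum_mul, Finset.mul_sum, mul_assoc, mul_left_comm _ (a _ _)]
    rw [integral_finsetSum _ fun k _ => integrable_finsetSum _ fun l _ => (I4 k l).const_mul _,
      Finset.mul_sum]
    refine Finset.sum_congr rfl fun k _ => ?_
    rw [integral_finsetSum _ fun l _ => (I3 k l).const_mul _,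
      integral_finsetSum _ fun l _ => (I4 k l).const_mul _, Finset.mul_sum]
    refine Finset.sum_congr rfl fun l _ => ?_
    rw [integral_const_mul, integral_const_mul, e3]
    ring
  rw [hJ', hSval] at hJ
  have hinv := (hasDerivAt_inv hτ.ne').mul hJ
  refine (hinv.neg.congr_of_eventuallyEq ?_).congr_deriv ?_
  · filter_upwards [isOpen_ne.mem_nhds hτ.ne'] with σ hσ using hF σ hσ
  · field_simp
    ring

end PartialDerivatives

section CoefficientInverse

variable {n : ℕ}

/-- The operator on `ℝⁿ` with matrix `a`. -/
noncomputable def coeffOp (a : Fin n → Fin n → ℝ) :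
    EuclideanSpace ℝ (Fin n) →L[ℝ] EuclideanSpace ℝ (Fin n) :=
  Matrix.toEuclideanCLM (𝕜 := ℝ) (Matrix.of a)

lemma coeffOp_apply (a : Fin n → Fin n → ℝ) (w : EuclideanSpace ℝ (Fin n)) (k : Fin n) :
    coeffOp a w k = ∑ l, a k l * w l := by
  simp [coeffOp, Matrix.mulVec, dotProduct]

lemma norm_le_sum_abs (v : EuclideanSpace ℝ (Fin n)) : ‖v‖ ≤ ∑ k, |v k| := by
  conv_lhs => rw [← (EuclideanSpace.basisFun (Fin n) ℝ).sum_repr v]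
  refine (norm_sum_le _ _).trans (Finset.sum_le_sum fun k _ => ?_)
  simp [norm_smul]

lemma abs_coord_le_norm (v : EuclideanSpace ℝ (Fin n)) (k : Fin n) : |v k| ≤ ‖v‖ := by
  simpa using PiLp.norm_apply_le v k

lemma norm_coeffOp_apply_le {a : Fin n → Fin n → ℝ} {m : ℝ} (hm : ∀ k l, |a k l| ≤ m)
    (w : EuclideanSpace ℝ (Fin n)) : ‖coeffOp a w‖ ≤ n ^ 2 * m * ‖w‖ := by
  calc ‖coeffOp a w‖ ≤ ∑ k, |coeffOp a w k| := norm_le_sum_abs _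
    _ ≤ ∑ _k : Fin n, ∑ _l : Fin n, m * ‖w‖ := by
        refine Finset.sum_le_sum fun k _ => ?_
        rw [coeffOp_apply]
        refine (Finset.abs_sum_le_sum_abs _ _).trans (Finset.sum_le_sum fun l _ => ?_)
        rw [abs_mul]
        exact mul_le_mul (hm k l) (abs_coord_le_norm w l) (abs_nonneg _)
          ((abs_nonneg _).trans (hm k l))
    _ = n ^ 2 * m * ‖w‖ := by simp; ring

lemma inner_coeffOp (a : Fin n → Fin n → ℝ) (v w : EuclideanSpace ℝ (Fin n)) :
    inner ℝ v (coeffOp a w) = ∑ i, ∑ j, a i j * v i * w j := by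
  simp only [PiLp.inner_apply, coeffOp_apply]
  refine Finset.sum_congr rfl fun i _ => ?_
  simp [Finset.sum_mul]
  exact Finset.sum_congr rfl fun j _ => by ring

/-- `B` is the inverse of the symmetric elliptic matrix `a`, with norm at most `b` and
ellipticity constant `lam`. -/
structure IsEllInverse (a : Fin n → Fin n → ℝ)
    (B : EuclideanSpace ℝ (Fin n) →L[ℝ] EuclideanSpace ℝ (Fin n)) (b lam : ℝ) : Prop where
  right_inv : ∀ w, coeffOp a (B w) = w
  left_inv : ∀ w, B (coeffOp a w) = w
  symm : ∀ v w, inner ℝ v (B w) = inner ℝ (B v) w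
  norm_le : ‖B‖ ≤ b
  lower : ∀ w, lam * ‖w‖ ^ 2 ≤ inner ℝ w (B w)

lemma exists_isEllInverse {a : Fin n → Fin n → ℝ} (hsymm : ∀ i j, a i j = a j i) {ν m : ℝ}
    (hν : 0 < ν) (hell : ∀ ξ : EuclideanSpace ℝ (Fin n),
      ν * ‖ξ‖ ^ 2 ≤ ∑ i, ∑ j, a i j * ξ i * ξ j) (hm : 0 < n ^ 2 * m)
    (ham : ∀ k l, |a k l| ≤ m) :
    ∃ B, IsEllInverse a B ν⁻¹ (ν / (n ^ 2 * m) ^ 2) := by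
  have hcoer : ∀ ξ, ν * ‖ξ‖ ^ 2 ≤ inner ℝ ξ (coeffOp a ξ) := by
    intro ξ; rw [inner_coeffOp]; exact hell ξ
  have hinj : Function.Injective (coeffOp a).toLinearMap := by
    rw [← LinearMap.ker_eq_bot, LinearMap.ker_eq_bot']
    intro ξ hξ
    have hξ' : coeffOp a ξ = 0 := hξ
    have := hcoer ξ
    rw [hξ', inner_zero_right] at this
    have h2 : ‖ξ‖ ^ 2 ≤ 0 := by
      by_contra h
      push Not at h
      nlinarith [mul_pos hν h]
    simpa using pow_eq_zero_iff (two_ne_zero) |>.mp (le_antisymm h2 (sq_nonneg _))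
  let e := LinearEquiv.ofInjectiveEndo (coeffOp a).toLinearMap hinj
  let B : EuclideanSpace ℝ (Fin n) →L[ℝ] EuclideanSpace ℝ (Fin n) :=
    LinearMap.toContinuousLinearMap e.symm.toLinearMap
  have hr : ∀ w, coeffOp a (B w) = w := fun w => e.apply_symm_apply w
  have hl : ∀ w, B (coeffOp a w) = w := fun w => e.symm_apply_apply w
  have hTsymm : ∀ v w, inner ℝ v (coeffOp a w) = inner ℝ (coeffOp a v) w := by
    intro v w
    rw [real_inner_comm w (coeffOp a v), inner_coeffOp, inner_coeffOp, Finset.sum_comm]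
    refine Finset.sum_congr rfl fun i _ => Finset.sum_congr rfl fun j _ => ?_
    rw [hsymm]; ring
  have hlow : ∀ w, ν * ‖B w‖ ^ 2 ≤ inner ℝ w (B w) := by
    intro w
    have := hcoer (B w)
    rwa [hr, real_inner_comm] at this
  refine ⟨B, hr, hl, ?_, ?_, ?_⟩
  · intro v w
    conv_lhs => rw [← hr v]
    rw [← hTsymm, hr]
  · refine ContinuousLinearMap.opNorm_le_bound _ (inv_nonneg.mpr hν.le) fun w => ?_
    have h1 := (hlow w).trans (real_inner_le_norm _ _)
    rcases (norm_nonneg (B w)).eq_or_lt with h0 | h0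
    · rw [← h0]; positivity
    · rw [inv_mul_eq_div, le_div_iff₀ hν]
      have : (‖B w‖ * ν) * ‖B w‖ ≤ ‖w‖ * ‖B w‖ := by nlinarith
      exact le_of_mul_le_mul_right this h0
  · intro w
    refine le_trans ?_ (hlow w)
    have h1 := norm_coeffOp_apply_le ham (B w)
    rw [hr] at h1
    have h2 : ‖w‖ ^ 2 ≤ (n ^ 2 * m * ‖B w‖) ^ 2 := by gcongr
    rw [div_mul_eq_mul_div, div_le_iff₀ (by positivity)]
    nlinarith

lemma IsEllInverse.norm_sub_le {a a' : Fin n → Fin n → ℝ}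
    {B B' : EuclideanSpace ℝ (Fin n) →L[ℝ] EuclideanSpace ℝ (Fin n)} {b lam m : ℝ}
    (h : IsEllInverse a B b lam) (h' : IsEllInverse a' B' b lam)
    (hm : ∀ k l, |a k l - a' k l| ≤ m) (hm0 : 0 ≤ m) :
    ‖B - B'‖ ≤ b ^ 2 * (n ^ 2 * m) := by
  have hb : 0 ≤ b := (norm_nonneg _).trans h.norm_le
  refine ContinuousLinearMap.opNorm_le_bound _ (by positivity) fun w => ?_
  have e : (B - B') w = -B (coeffOp (fun k l => a k l - a' k l) (B' w)) := by
    have : coeffOp (fun k l => a k l - a' k l) (B' w) = coeffOp a (B' w) - w := by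
      have h0 : coeffOp (fun k l => a k l - a' k l) (B' w) =
          coeffOp a (B' w) - coeffOp a' (B' w) := by
        ext k
        simp only [PiLp.sub_apply, coeffOp_apply, sub_mul, Finset.sum_sub_distrib]
      rw [h0, h'.right_inv]
    rw [this, map_sub, h.left_inv]
    simp
  rw [e, norm_neg]
  have h1 := (B.le_opNorm (coeffOp (fun k l => a k l - a' k l) (B' w)))
  have h2 := norm_coeffOp_apply_le hm (B' w)
  have h3 := B'.le_opNorm w
  calc _ ≤ ‖B‖ * ‖coeffOp (fun k l => a k l - a' k l) (B' w)‖ := h1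
    _ ≤ b * (n ^ 2 * m * (b * ‖w‖)) := by
        gcongr
        · exact h.norm_le
        · refine h2.trans ?_
          gcongr
          exact h3.trans (by gcongr; exact h'.norm_le)
    _ = _ := by ring

end CoefficientInverse

section EllipticKernel

variable {n : ℕ}

/-- A smooth bump adapted to the quadratic form of `B`. -/
noncomputable def ellBump (B : EuclideanSpace ℝ (Fin n) →L[ℝ] EuclideanSpace ℝ (Fin n))
    (w : EuclideanSpace ℝ (Fin n)) : ℝ :=
  Real.smoothTransition (2 - inner ℝ w (B w))

/-- The components of `ellBump B w • B w`. -/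
noncomputable def ellGrad (B : EuclideanSpace ℝ (Fin n) →L[ℝ] EuclideanSpace ℝ (Fin n))
    (i : Fin n) (w : EuclideanSpace ℝ (Fin n)) : ℝ :=
  ellBump B w * B w i

lemma contDiff_ellBump_uncurry :
    ContDiff ℝ 3 (fun p : (EuclideanSpace ℝ (Fin n) →L[ℝ] EuclideanSpace ℝ (Fin n)) ×
      EuclideanSpace ℝ (Fin n) => ellBump p.1 p.2) := by
  refine (Real.smoothTransition.contDiff (n := 3)).comp ?_
  exact contDiff_const.sub (contDiff_snd.inner ℝ (contDiff_fst.clm_apply contDiff_snd))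

lemma contDiff_ellGrad_uncurry (i : Fin n) :
    ContDiff ℝ 3 (fun p : (EuclideanSpace ℝ (Fin n) →L[ℝ] EuclideanSpace ℝ (Fin n)) ×
      EuclideanSpace ℝ (Fin n) => ellGrad p.1 i p.2) := by
  have h : ContDiff ℝ 3 (fun p : (EuclideanSpace ℝ (Fin n) →L[ℝ] EuclideanSpace ℝ (Fin n)) ×
      EuclideanSpace ℝ (Fin n) => p.1 p.2) := contDiff_fst.clm_apply contDiff_snd
  exact contDiff_ellBump_uncurry.mul
    ((EuclideanSpace.proj (𝕜 := ℝ) i : EuclideanSpace ℝ (Fin n) →L[ℝ] ℝ).contDiff.comp h)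

lemma contDiff_ellBump (B : EuclideanSpace ℝ (Fin n) →L[ℝ] EuclideanSpace ℝ (Fin n)) :
    ContDiff ℝ 3 (ellBump B) :=
  ContDiff.comp (g := fun p : (EuclideanSpace ℝ (Fin n) →L[ℝ] EuclideanSpace ℝ (Fin n)) ×
    EuclideanSpace ℝ (Fin n) => ellBump p.1 p.2) (f := fun w => (B, w))
    contDiff_ellBump_uncurry (contDiff_const.prodMk contDiff_id)

lemma contDiff_ellGrad (B : EuclideanSpace ℝ (Fin n) →L[ℝ] EuclideanSpace ℝ (Fin n)) (i : Fin n) :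
    ContDiff ℝ 3 (ellGrad B i) :=
  ContDiff.comp (g := fun p : (EuclideanSpace ℝ (Fin n) →L[ℝ] EuclideanSpace ℝ (Fin n)) ×
    EuclideanSpace ℝ (Fin n) => ellGrad p.1 i p.2) (f := fun w => (B, w))
    (contDiff_ellGrad_uncurry i) (contDiff_const.prodMk contDiff_id)

lemma contDiff_pd1_ellBump_uncurry (i : Fin n) :
    ContDiff ℝ 1 (fun p : (EuclideanSpace ℝ (Fin n) →L[ℝ] EuclideanSpace ℝ (Fin n)) ×
      EuclideanSpace ℝ (Fin n) => pd1 (ellBump p.1) i p.2) := by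
  have h : ContDiff ℝ 3 (Function.uncurry fun
      (p : (EuclideanSpace ℝ (Fin n) →L[ℝ] EuclideanSpace ℝ (Fin n)) × EuclideanSpace ℝ (Fin n))
      (w : EuclideanSpace ℝ (Fin n)) => ellBump p.1 w) :=
    ContDiff.comp (g := fun p : (EuclideanSpace ℝ (Fin n) →L[ℝ] EuclideanSpace ℝ (Fin n)) ×
        EuclideanSpace ℝ (Fin n) => ellBump p.1 p.2)
      (f := fun q : ((EuclideanSpace ℝ (Fin n) →L[ℝ] EuclideanSpace ℝ (Fin n)) ×
        EuclideanSpace ℝ (Fin n)) × EuclideanSpace ℝ (Fin n) => (q.1.1, q.2))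
      contDiff_ellBump_uncurry ((contDiff_fst.comp contDiff_fst).prodMk contDiff_snd)
  exact (ContDiff.fderiv (m := 3) (n := 1) h contDiff_snd (by norm_num)).clm_apply contDiff_const

lemma contDiff_pd1_ellGrad_uncurry (i j : Fin n) :
    ContDiff ℝ 1 (fun p : (EuclideanSpace ℝ (Fin n) →L[ℝ] EuclideanSpace ℝ (Fin n)) ×
      EuclideanSpace ℝ (Fin n) => pd1 (ellGrad p.1 i) j p.2) := by
  have h : ContDiff ℝ 3 (Function.uncurry fun
      (p : (EuclideanSpace ℝ (Fin n) →L[ℝ] EuclideanSpace ℝ (Fin n)) × EuclideanSpace ℝ (Fin n))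
      (w : EuclideanSpace ℝ (Fin n)) => ellGrad p.1 i w) :=
    ContDiff.comp (g := fun p : (EuclideanSpace ℝ (Fin n) →L[ℝ] EuclideanSpace ℝ (Fin n)) ×
        EuclideanSpace ℝ (Fin n) => ellGrad p.1 i p.2)
      (f := fun q : ((EuclideanSpace ℝ (Fin n) →L[ℝ] EuclideanSpace ℝ (Fin n)) ×
        EuclideanSpace ℝ (Fin n)) × EuclideanSpace ℝ (Fin n) => (q.1.1, q.2))
      (contDiff_ellGrad_uncurry i) ((contDiff_fst.comp contDiff_fst).prodMk contDiff_snd)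
  exact (ContDiff.fderiv (m := 3) (n := 1) h contDiff_snd (by norm_num)).clm_apply contDiff_const

lemma pd1_ellGrad_comm {B : EuclideanSpace ℝ (Fin n) →L[ℝ] EuclideanSpace ℝ (Fin n)}
    (hB : ∀ v w, inner ℝ v (B w) = inner ℝ (B v) w) (i l : Fin n) :
    pd1 (ellGrad B l) i = pd1 (ellGrad B i) l := by
  have hq : ∀ k w, pd1 (ellBump B) k w =
      -2 * deriv Real.smoothTransition (2 - inner ℝ w (B w)) * B w k := by
    intro k w
    have h1 : HasFDerivAt (fun w => 2 - inner ℝ w (B w)) _ w :=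
      ((hasFDerivAt_id w).inner ℝ B.hasFDerivAt).const_sub 2
    have h2 := (Real.smoothTransition.contDiff (n := 1)).differentiable (by norm_num)
      (2 - inner ℝ w (B w))
    have := (h2.hasDerivAt.comp_hasFDerivAt w h1).fderiv
    unfold pd1
    erw [this]
    have h3 : inner ℝ w (B (EuclideanSpace.single k (1 : ℝ))) = B w k := by
      rw [hB]; simp [EuclideanSpace.inner_single_right]
    simp [h3, EuclideanSpace.inner_single_left]
    ring
  have hp : ∀ k m w, pd1 (fun w => B w k) m w = B (EuclideanSpace.single m 1) k := by
    intro k m w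
    have := ((EuclideanSpace.proj (𝕜 := ℝ) k : EuclideanSpace ℝ (Fin n) →L[ℝ] ℝ).comp B).fderiv
      (x := w)
    unfold pd1
    erw [this]
    simp
  have hBd : ∀ k, Differentiable ℝ (fun w => B w k) := fun k =>
    ((EuclideanSpace.proj (𝕜 := ℝ) k : EuclideanSpace ℝ (Fin n) →L[ℝ] ℝ).comp B).differentiable
  have hbd := (contDiff_ellBump B).differentiable (by norm_num)
  have hBs : B (EuclideanSpace.single i 1) l = B (EuclideanSpace.single l 1) i := by
    have := hB (EuclideanSpace.single l (1 : ℝ)) (EuclideanSpace.single i (1 : ℝ))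
    simpa [EuclideanSpace.inner_single_left, EuclideanSpace.inner_single_right] using this
  ext w
  unfold ellGrad
  rw [pd1_mul hbd (hBd l), pd1_mul hbd (hBd i), hq, hq, hp, hp, hBs]
  ring

lemma ellBump_eq_zero {B : EuclideanSpace ℝ (Fin n) →L[ℝ] EuclideanSpace ℝ (Fin n)} {lam Q : ℝ}
    (hlow : ∀ w, lam * ‖w‖ ^ 2 ≤ inner ℝ w (B w)) (hlam : 0 < lam) (hQ : 0 ≤ Q)
    (hlQ : 2 ≤ lam * Q ^ 2) {w : EuclideanSpace ℝ (Fin n)} (hw : w ∉ closedBall 0 Q) :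
    ellBump B w = 0 := by
  refine Real.smoothTransition.zero_of_nonpos ?_
  have h1 : Q ≤ ‖w‖ := by simpa using (not_le.mp (by simpa using hw)).le
  have h2 : lam * Q ^ 2 ≤ lam * ‖w‖ ^ 2 := by gcongr
  linarith [hlow w]

lemma pd1_eq_zero_of_notMem {f : EuclideanSpace ℝ (Fin n) → ℝ} {Q : ℝ}
    (hf : ∀ w, w ∉ closedBall 0 Q → f w = 0) (k : Fin n) {w : EuclideanSpace ℝ (Fin n)}
    (hw : w ∉ closedBall 0 Q) : pd1 f k w = 0 := by
  have : f =ᶠ[𝓝 w] fun _ => 0 := by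
    filter_upwards [isClosed_closedBall.isOpen_compl.mem_nhds hw] with y hy using hf y hy
  unfold pd1
  rw [this.fderiv_eq]
  simp

lemma hasCompactSupport_of_eq_zero {f : EuclideanSpace ℝ (Fin n) → ℝ} {Q : ℝ}
    (hf : ∀ w, w ∉ closedBall 0 Q → f w = 0) : HasCompactSupport f :=
  HasCompactSupport.intro (isCompact_closedBall 0 Q) fun {w} hw => hf w hw

lemma exists_pos_le_integral_ellBump (n : ℕ) {b : ℝ} (hb : 0 ≤ b) :
    ∃ c : ℝ, 0 < c ∧ ∀ B : EuclideanSpace ℝ (Fin n) →L[ℝ] EuclideanSpace ℝ (Fin n),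
      ‖B‖ ≤ b → HasCompactSupport (ellBump B) → c ≤ ∫ w, ellBump B w := by
  refine ⟨volume.real (closedBall (0 : EuclideanSpace ℝ (Fin n)) (1 + b)⁻¹), ?_, ?_⟩
  · exact ENNReal.toReal_pos (measure_closedBall_pos _ _ (by positivity)).ne'
      measure_closedBall_lt_top.ne
  · intro B hB hc
    have hint := (contDiff_ellBump B).continuous.integrable_of_hasCompactSupport hc (μ := volume)
    refine le_trans (le_of_eq ?_) (setIntegral_le_integral (s := closedBall 0 (1 + b)⁻¹) hint
      (Eventually.of_forall fun w => Real.smoothTransition.nonneg _))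
    rw [setIntegral_congr_fun (g := fun _ => (1 : ℝ)) isClosed_closedBall.measurableSet]
    · simp
    · intro w hw
      refine Real.smoothTransition.one_of_one_le ?_
      have h1 : ‖w‖ ≤ (1 + b)⁻¹ := by simpa using hw
      have h2 : inner ℝ w (B w) ≤ ‖w‖ * (b * ‖w‖) := (real_inner_le_norm _ _).trans
        (by gcongr; exact (B.le_opNorm w).trans (by gcongr))
      have h3 : ‖w‖ * (b * ‖w‖) ≤ (1 + b)⁻¹ * (b * (1 + b)⁻¹) := by gcongr
      have h4 : (1 + b)⁻¹ * (b * (1 + b)⁻¹) ≤ 1 := by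
        have e1 : (1 + b)⁻¹ ≤ 1 := inv_le_one_of_one_le₀ (by linarith)
        have e2 : b * (1 + b)⁻¹ ≤ 1 := by
          rw [← div_eq_mul_inv, div_le_one (by positivity)]; linarith
        exact mul_le_one₀ e1 (by positivity) e2
      linarith

/-- Bounds on the elliptic kernels that are uniform over bounded operators. -/
structure EllKernelBound (n : ℕ) (b Q L : ℝ) : Prop where
  bump_sub : ∀ B B' : EuclideanSpace ℝ (Fin n) →L[ℝ] EuclideanSpace ℝ (Fin n), ‖B‖ ≤ b → ‖B'‖ ≤ b →
    ∀ w ∈ closedBall (0 : EuclideanSpace ℝ (Fin n)) Q,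
      |ellBump B w - ellBump B' w| ≤ L * ‖B - B'‖
  pd1_bump : ∀ B : EuclideanSpace ℝ (Fin n) →L[ℝ] EuclideanSpace ℝ (Fin n), ‖B‖ ≤ b →
    ∀ w ∈ closedBall (0 : EuclideanSpace ℝ (Fin n)) Q, ∀ i, |pd1 (ellBump B) i w| ≤ L
  pd1_grad : ∀ B : EuclideanSpace ℝ (Fin n) →L[ℝ] EuclideanSpace ℝ (Fin n), ‖B‖ ≤ b →
    ∀ w ∈ closedBall (0 : EuclideanSpace ℝ (Fin n)) Q, ∀ i j, |pd1 (ellGrad B i) j w| ≤ L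
  pd1_grad_sub : ∀ B : EuclideanSpace ℝ (Fin n) →L[ℝ] EuclideanSpace ℝ (Fin n), ‖B‖ ≤ b →
    ∀ w ∈ closedBall (0 : EuclideanSpace ℝ (Fin n)) Q,
    ∀ w' ∈ closedBall (0 : EuclideanSpace ℝ (Fin n)) Q, ∀ i j,
      |pd1 (ellGrad B i) j w - pd1 (ellGrad B i) j w'| ≤ L * ‖w - w'‖

lemma exists_ellKernelBound (n : ℕ) (b Q : ℝ) : ∃ L, 0 ≤ L ∧ EllKernelBound n b Q L := by
  let K : Set ((EuclideanSpace ℝ (Fin n) →L[ℝ] EuclideanSpace ℝ (Fin n)) ×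
    EuclideanSpace ℝ (Fin n)) := closedBall 0 b ×ˢ closedBall 0 Q
  have hK : IsCompact K := (isCompact_closedBall _ _).prod (isCompact_closedBall _ _)
  have hKc : Convex ℝ K := (convex_closedBall _ _).prod (convex_closedBall _ _)
  have hmem : ∀ (B : EuclideanSpace ℝ (Fin n) →L[ℝ] EuclideanSpace ℝ (Fin n)) w, ‖B‖ ≤ b →
      w ∈ closedBall (0 : EuclideanSpace ℝ (Fin n)) Q → (B, w) ∈ K := fun B w hB hw =>
    ⟨by simpa using hB, hw⟩
  have key : ∀ f : (EuclideanSpace ℝ (Fin n) →L[ℝ] EuclideanSpace ℝ (Fin n)) ×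
      EuclideanSpace ℝ (Fin n) → ℝ, ContDiff ℝ 1 f → ∀ᶠ L : ℝ in atTop,
      (∀ p ∈ K, |f p| ≤ L) ∧ ∀ p ∈ K, ∀ q ∈ K, |f p - f q| ≤ L * ‖p - q‖ := by
    intro f hf
    obtain ⟨C, hC⟩ := hK.exists_bound_of_continuousOn hf.continuous.continuousOn
    obtain ⟨D, hD⟩ := hf.contDiffOn.exists_lipschitzOnWith (by norm_num) hKc hK
    filter_upwards [eventually_ge_atTop C, eventually_ge_atTop (D : ℝ)] with L h1 h2
    refine ⟨fun p hp => (hC p hp).trans h1, fun p hp q hq => ?_⟩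
    have := hD.dist_le_mul p hp q hq
    rw [Real.dist_eq, dist_eq_norm] at this
    exact this.trans (by gcongr)
  have e1 := key (fun p : (EuclideanSpace ℝ (Fin n) →L[ℝ] EuclideanSpace ℝ (Fin n)) ×
      EuclideanSpace ℝ (Fin n) => ellBump p.1 p.2)
    (contDiff_ellBump_uncurry.of_le (by norm_num))
  have e2 := eventually_all.mpr fun i => key (fun p : (EuclideanSpace ℝ (Fin n) →L[ℝ] EuclideanSpace ℝ (Fin n)) ×
      EuclideanSpace ℝ (Fin n) => pd1 (ellBump p.1) i p.2)
    (contDiff_pd1_ellBump_uncurry i)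
  have e3 := eventually_all.mpr fun i => eventually_all.mpr fun j =>
    key (fun p : (EuclideanSpace ℝ (Fin n) →L[ℝ] EuclideanSpace ℝ (Fin n)) ×
      EuclideanSpace ℝ (Fin n) => pd1 (ellGrad p.1 i) j p.2)
    (contDiff_pd1_ellGrad_uncurry i j)
  obtain ⟨L, ⟨h0, h1⟩, h2, h3⟩ := (((eventually_ge_atTop 0).and e1).and (e2.and e3)).exists
  refine ⟨L, h0, ?_, ?_, ?_, ?_⟩
  · intro B B' hB hB' w hw
    simpa [Prod.norm_def] using h1.2 (B, w) (hmem B w hB hw) (B', w) (hmem B' w hB' hw)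
  · intro B hB w hw i
    exact (h2 i).1 (B, w) (hmem B w hB hw)
  · intro B hB w hw i j
    exact (h3 i j).1 (B, w) (hmem B w hB hw)
  · intro B hB w hw w' hw' i j
    simpa [Prod.norm_def] using (h3 i j).2 (B, w) (hmem B w hB hw) (B, w') (hmem B w' hB hw')

end EllipticKernel

section OneVariable

lemma abs_sub_le_of_abs_deriv_le {f g f' g' : ℝ → ℝ} {a b : ℝ} (hab : a ≤ b)
    (hf : ContinuousOn f (Icc a b)) (hg : ContinuousOn g (Icc a b))
    (hf' : ∀ x ∈ Ioo a b, HasDerivAt f (f' x) x) (hg' : ∀ x ∈ Ioo a b, HasDerivAt g (g' x) x)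
    (hle : ∀ x ∈ Ioo a b, |f' x| ≤ g' x) : |f b - f a| ≤ g b - g a := by
  have h1 : MonotoneOn (fun x => g x - f x) (Icc a b) := by
    refine monotoneOn_of_hasDerivWithinAt_nonneg (f' := fun x => g' x - f' x) (convex_Icc a b)
      (hg.sub hf) ?_ ?_ <;> intro x hx <;> rw [interior_Icc] at hx
    · exact ((hg' x hx).sub (hf' x hx)).hasDerivWithinAt
    · exact sub_nonneg.mpr ((le_abs_self _).trans (hle x hx))
  have h2 : MonotoneOn (fun x => g x + f x) (Icc a b) := by
    refine monotoneOn_of_hasDerivWithinAt_nonneg (f' := fun x => g' x + f' x) (convex_Icc a b)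
      (hg.add hf) ?_ ?_ <;> intro x hx <;> rw [interior_Icc] at hx
    · exact ((hg' x hx).add (hf' x hx)).hasDerivWithinAt
    · linarith [(neg_le_abs (f' x)).trans (hle x hx)]
  have h3 := h1 (left_mem_Icc.mpr hab) (right_mem_Icc.mpr hab) hab
  have h4 := h2 (left_mem_Icc.mpr hab) (right_mem_Icc.mpr hab) hab
  rw [abs_le]
  constructor <;> simp only at h3 h4 <;> linarith

variable {ω : ℝ → ℝ} {R : ℝ}

lemma IsOsc.nonneg (hω : IsOsc ω R) {r : ℝ} (h0 : 0 ≤ r) (hr : r ≤ R) : 0 ≤ ω r := by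
  rcases h0.eq_or_lt with rfl | h
  · exact hω.zero.ge
  · exact (hω.pos r h hr).le

lemma intervalIntegrable_div_self (hdini : IntegrableOn (fun s => ω s / s) (Ioc 0 R)) {a b : ℝ}
    (ha : 0 ≤ a) (hb : 0 ≤ b) (haR : a ≤ R) (hbR : b ≤ R) :
    IntervalIntegrable (fun s => ω s / s) volume a b := by
  rw [intervalIntegrable_iff]
  refine hdini.mono_set fun x hx => ?_
  rw [uIoc, mem_Ioc] at hx
  exact ⟨lt_of_le_of_lt (le_min ha hb) hx.1, hx.2.trans (max_le haR hbR)⟩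

lemma stronglyMeasurableAtFilter_of_continuousOn_Ioo {f : ℝ → ℝ} (hf : ContinuousOn f (Ioo 0 R))
    {r : ℝ} (hr : r ∈ Ioo 0 R) : StronglyMeasurableAtFilter f (𝓝 r) volume :=
  hf.stronglyMeasurableAtFilter isOpen_Ioo r hr

lemma IsOsc.continuousOn_div_pow (hω : IsOsc ω R) (k : ℕ) :
    ContinuousOn (fun s => ω s / s ^ k) (Ioo 0 R) :=
  (hω.cont.mono Ioo_subset_Icc_self).div (continuousOn_id.pow k) fun _ hx => (pow_pos hx.1 k).ne'

lemma IsOsc.hasDerivAt_integral_div_self (hω : IsOsc ω R)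
    (hdini : IntegrableOn (fun s => ω s / s) (Ioc 0 R)) {r : ℝ} (hr : r ∈ Ioo 0 R) :
    HasDerivAt (fun r => ∫ s in (0 : ℝ)..r, ω s / s) (ω r / r) r := by
  have hc : ContinuousOn (fun s => ω s / s) (Ioo 0 R) := by
    simpa using hω.continuousOn_div_pow 1
  exact intervalIntegral.integral_hasDerivAt_right
    (intervalIntegrable_div_self hdini le_rfl hr.1.le (hr.1.trans hr.2).le hr.2.le)
    (stronglyMeasurableAtFilter_of_continuousOn_Ioo hc hr)
    (hc.continuousAt (Ioo_mem_nhds hr.1 hr.2))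

lemma continuousOn_integral_div_self (hR : 0 ≤ R)
    (hdini : IntegrableOn (fun s => ω s / s) (Ioc 0 R)) :
    ContinuousOn (fun r => ∫ s in (0 : ℝ)..r, ω s / s) (Icc 0 R) := by
  have := intervalIntegral.continuousOn_primitive_interval' (a := 0)
    (intervalIntegrable_div_self hdini le_rfl hR hR le_rfl) left_mem_uIcc
  rwa [uIcc_of_le hR] at this

lemma IsOsc.monotoneOn_integral_div_self (hω : IsOsc ω R) (hR : 0 ≤ R)
    (hdini : IntegrableOn (fun s => ω s / s) (Ioc 0 R)) :
    MonotoneOn (fun r => ∫ s in (0 : ℝ)..r, ω s / s) (Icc 0 R) := by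
  refine monotoneOn_of_hasDerivWithinAt_nonneg (f' := fun x => ω x / x) (convex_Icc 0 R)
      (continuousOn_integral_div_self hR hdini) ?_ ?_ <;> intro x hx <;> rw [interior_Icc] at hx
  · exact (hω.hasDerivAt_integral_div_self hdini hx).hasDerivWithinAt
  · exact div_nonneg (hω.nonneg hx.1.le hx.2.le) hx.1.le

lemma IsOsc.le_integral_div_self (hω : IsOsc ω R)
    (hdini : IntegrableOn (fun s => ω s / s) (Ioc 0 R)) {δ : ℝ}
    (hδ : ∀ s ∈ Ioo 0 δ, s ≤ ω s) {r : ℝ} (h0 : 0 ≤ r) (hr : r ≤ R) (hrδ : r ≤ δ) :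
    r ≤ ∫ s in (0 : ℝ)..r, ω s / s := by
  have h := abs_sub_le_of_abs_deriv_le (f := id) (f' := fun _ => 1) (g' := fun s => ω s / s) h0
    continuousOn_id ((continuousOn_integral_div_self (h0.trans hr) hdini).mono
      (Icc_subset_Icc_right hr)) (fun x _ => hasDerivAt_id x)
    (fun x hx => hω.hasDerivAt_integral_div_self hdini ⟨hx.1, hx.2.trans_le hr⟩)
    (fun x hx => by
      rw [abs_one, le_div_iff₀ hx.1, one_mul]
      exact hδ x ⟨hx.1, hx.2.trans_le hrδ⟩)
  simpa [abs_of_nonneg h0] using h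

lemma IsOsc.hasDerivAt_integral_div_sq (hω : IsOsc ω R) {a r : ℝ} (ha : a ∈ Ioo 0 R)
    (hr : r ∈ Ioo 0 R) :
    HasDerivAt (fun r => ∫ s in a..r, ω s / s ^ 2) (ω r / r ^ 2) r := by
  have hc := hω.continuousOn_div_pow 2
  refine intervalIntegral.integral_hasDerivAt_right (ContinuousOn.intervalIntegrable ?_)
    (stronglyMeasurableAtFilter_of_continuousOn_Ioo hc hr)
    (hc.continuousAt (Ioo_mem_nhds hr.1 hr.2))
  exact hc.mono (ordConnected_Ioo.uIcc_subset ha hr)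

lemma IsOsc.integral_div_sq_le (hω : IsOsc ω R) {a b : ℝ} (ha : 0 < a) (hab : a ≤ b)
    (hb : b ≤ R) : ∫ s in a..b, ω s / s ^ 2 ≤ ∫ s in a..R, ω s / s ^ 2 := by
  refine intervalIntegral.integral_mono_interval le_rfl hab hb ?_ ?_
  · refine (ae_restrict_iff' measurableSet_Ioc).mpr (Eventually.of_forall fun x hx => ?_)
    exact div_nonneg (hω.nonneg (ha.trans hx.1).le hx.2) (sq_nonneg x)
  · refine ContinuousOn.intervalIntegrable ?_
    rw [uIcc_of_le (hab.trans hb)]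
    exact (hω.cont.mono (Icc_subset_Icc_left ha.le)).div (continuousOn_id.pow 2)
      fun _ hx => (pow_pos (ha.trans_le hx.1) 2).ne'

end OneVariable

section KernelIntegrals

variable {n : ℕ}

lemma abs_integral_le_of_abs_le {h : EuclideanSpace ℝ (Fin n) → ℝ} {Q M : ℝ}
    (h0 : ∀ w, w ∉ closedBall 0 Q → h w = 0) (hM : ∀ w ∈ closedBall 0 Q, |h w| ≤ M) :
    |∫ w, h w| ≤ M * volume.real (closedBall (0 : EuclideanSpace ℝ (Fin n)) Q) := by
  rw [← setIntegral_eq_integral_of_forall_compl_eq_zero h0]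
  exact norm_setIntegral_le_of_norm_le_const (f := h) measure_closedBall_lt_top hM

lemma abs_integral_mul_le_of_integral_eq_zero {k g : EuclideanSpace ℝ (Fin n) → ℝ} {Q L m c : ℝ}
    (hk : Continuous k) (h0 : ∀ w, w ∉ closedBall 0 Q → k w = 0) (hk0 : ∫ w, k w = 0)
    (hL : ∀ w ∈ closedBall 0 Q, |k w| ≤ L) (hg : Continuous g)
    (hm : ∀ w ∈ closedBall 0 Q, |g w - c| ≤ m) :
    |∫ w, k w * g w| ≤ L * m * volume.real (closedBall (0 : EuclideanSpace ℝ (Fin n)) Q) := by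
  have hc : HasCompactSupport k := hasCompactSupport_of_eq_zero h0
  have e : ∫ w, k w * g w = ∫ w, k w * (g w - c) := by
    have h1 : Integrable fun w => k w * g w :=
      (hk.mul hg).integrable_of_hasCompactSupport hc.mul_right
    have h2 : Integrable fun w => k w * c := (hk.integrable_of_hasCompactSupport hc).mul_const c
    simp_rw [mul_sub]
    rw [integral_sub h1 h2, integral_mul_const, hk0, zero_mul, sub_zero]
  rw [e]
  refine abs_integral_le_of_abs_le (fun w hw => by rw [h0 w hw, zero_mul]) fun w hw => ?_
  rw [abs_mul]
  exact mul_le_mul (hL w hw) (hm w hw) (abs_nonneg _) ((abs_nonneg _).trans (hL w hw))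

lemma continuous_integral_mul_comp_add_smul {f g : EuclideanSpace ℝ (Fin n) → ℝ}
    (hf : Continuous f) (hc : HasCompactSupport f) (hg : Continuous g)
    (hgc : HasCompactSupport g) (z : EuclideanSpace ℝ (Fin n)) :
    Continuous fun σ : ℝ => ∫ w, f w * g (z + σ • w) := by
  obtain ⟨D, hD⟩ := hgc.exists_bound_of_continuous hg
  refine continuous_of_dominated (bound := fun w => |f w| * D)
    (fun σ => Continuous.aestronglyMeasurable (by fun_prop))
    (fun σ => Eventually.of_forall fun w => ?_) ?_
    (Eventually.of_forall fun w => by fun_prop)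
  · rw [norm_mul]
    exact mul_le_mul_of_nonneg_left (hD _) (norm_nonneg _)
  · exact (hf.abs.mul continuous_const).integrable_of_hasCompactSupport
      (HasCompactSupport.mul_right (hc.comp_left (g := fun t : ℝ => |t|) abs_zero))

end KernelIntegrals

section AverageEstimates

variable {n : ℕ} {a : Fin n → Fin n → ℝ}
  {B : EuclideanSpace ℝ (Fin n) →L[ℝ] EuclideanSpace ℝ (Fin n)} {b lam Q L N R : ℝ} {ω : ℝ → ℝ}
  {u : EuclideanSpace ℝ (Fin n) → ℝ}

lemma continuous_pd2 (hu : ContDiff ℝ 2 u) (i j : Fin n) : Continuous (pd2 u i j) :=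
  (contDiff_pd1 (f := pd1 u j) (m := 0) (by simpa using contDiff_pd1 (m := 1) hu j) i).continuous

lemma hasCompactSupport_pd2 (huc : HasCompactSupport u) (i j : Fin n) :
    HasCompactSupport (pd2 u i j) :=
  hasCompactSupport_pd1 (hasCompactSupport_pd1 huc j) i

lemma continuous_sum_mul_pd2 (hu : ContDiff ℝ 2 u) (a : Fin n → Fin n → ℝ) :
    Continuous fun x => ∑ k, ∑ l, a k l * pd2 u k l x :=
  continuous_finsetSum _ fun k _ => continuous_finsetSum _ fun l _ =>
    continuous_const.mul (continuous_pd2 hu k l)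

lemma IsEllInverse.ellBump_eq_zero (h : IsEllInverse a B b lam) (hlam : 0 < lam) (hQ : 0 ≤ Q)
    (hlQ : 2 ≤ lam * Q ^ 2) (w : EuclideanSpace ℝ (Fin n)) (hw : w ∉ closedBall 0 Q) :
    ellBump B w = 0 :=
  _root_.ellBump_eq_zero h.lower hlam hQ hlQ hw

lemma IsEllInverse.ellGrad_eq_zero (h : IsEllInverse a B b lam) (hlam : 0 < lam) (hQ : 0 ≤ Q)
    (hlQ : 2 ≤ lam * Q ^ 2) (i : Fin n) (w : EuclideanSpace ℝ (Fin n)) (hw : w ∉ closedBall 0 Q) :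
    ellGrad B i w = 0 := by
  rw [ellGrad, h.ellBump_eq_zero hlam hQ hlQ w hw, zero_mul]

lemma continuous_pd1_ellGrad (B : EuclideanSpace ℝ (Fin n) →L[ℝ] EuclideanSpace ℝ (Fin n))
    (i j : Fin n) : Continuous (pd1 (ellGrad B i) j) :=
  (contDiff_pd1 (m := 2) (contDiff_ellGrad B i) j).continuous

lemma IsEllInverse.hasDerivAt_average (h : IsEllInverse a B b lam) (hlam : 0 < lam) (hQ : 0 ≤ Q)
    (hlQ : 2 ≤ lam * Q ^ 2) (hu : ContDiff ℝ 2 u) (huc : HasCompactSupport u) (i j : Fin n)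
    (z : EuclideanSpace ℝ (Fin n)) {τ : ℝ} (hτ : 0 < τ) :
    HasDerivAt (fun σ : ℝ => ∫ w, ellBump B w * pd2 u i j (z + σ • w))
      (-(τ⁻¹ * ∫ w, pd1 (ellGrad B i) j w * ∑ k, ∑ l, a k l * pd2 u k l (z + τ • w))) τ :=
  hasDerivAt_average_pd2 ((contDiff_ellBump B).of_le (by norm_num))
    (hasCompactSupport_of_eq_zero (h.ellBump_eq_zero hlam hQ hlQ))
    (fun i => (contDiff_ellGrad B i).of_le (by norm_num))
    (fun i => hasCompactSupport_of_eq_zero (h.ellGrad_eq_zero hlam hQ hlQ i))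
    (fun k w => by
      have := coeffOp_apply a (B w) k
      rw [h.right_inv] at this
      rw [this, Finset.sum_mul]
      exact Finset.sum_congr rfl fun l _ => by rw [ellGrad]; ring)
    (fun i l => pd1_ellGrad_comm h.symm i l) hu huc i j z hτ

lemma IsEllInverse.integral_pd1_ellGrad (h : IsEllInverse a B b lam) (hlam : 0 < lam)
    (hQ : 0 ≤ Q) (hlQ : 2 ≤ lam * Q ^ 2) (i j : Fin n) : ∫ w, pd1 (ellGrad B i) j w = 0 :=
  integral_pd1 ((contDiff_ellGrad B i).of_le (by norm_num))
    (hasCompactSupport_of_eq_zero (h.ellGrad_eq_zero hlam hQ hlQ i)) j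

/-- Shrinking the scale of the average to zero costs the Dini integral of `ω`. -/
lemma IsEllInverse.abs_average_sub_average_zero_le (h : IsEllInverse a B b lam) (hlam : 0 < lam)
    (hQ : 0 < Q) (hlQ : 2 ≤ lam * Q ^ 2) (hL : EllKernelBound n b (3 * Q) L) (hω : IsOsc ω R)
    (hdini : IntegrableOn (fun s => ω s / s) (Ioc 0 R)) (hN0 : 0 ≤ N)
    (hu : ContDiff ℝ 2 u) (huc : HasCompactSupport u) (i j : Fin n)
    (z : EuclideanSpace ℝ (Fin n)) {s : ℝ} (hs : 0 ≤ s) (hsR : Q * s ≤ R)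
    (hN : ∀ w : EuclideanSpace ℝ (Fin n), ‖w‖ ≤ Q * s →
      |∑ k, ∑ l, a k l * pd2 u k l (z + w) - ∑ k, ∑ l, a k l * pd2 u k l z| ≤ N * ω ‖w‖) :
    |(∫ w, ellBump B w * pd2 u i j (z + s • w)) -
        ∫ w, ellBump B w * pd2 u i j (z + (0 : ℝ) • w)| ≤
      L * N * volume.real (closedBall (0 : EuclideanSpace ℝ (Fin n)) Q) *
        ∫ t in (0 : ℝ)..Q * s, ω t / t := by
  set V := volume.real (closedBall (0 : EuclideanSpace ℝ (Fin n)) Q)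
  have hF := (continuous_integral_mul_comp_add_smul (contDiff_ellBump B).continuous
    (hasCompactSupport_of_eq_zero (h.ellBump_eq_zero hlam hQ.le hlQ)) (continuous_pd2 hu i j)
    (hasCompactSupport_pd2 huc i j) z)
  have hR : 0 ≤ R := le_trans (by positivity) hsR
  have key := abs_sub_le_of_abs_deriv_le hs hF.continuousOn
    (g := fun τ => L * N * V * ∫ t in (0 : ℝ)..Q * τ, ω t / t)
    (f' := fun τ => -(τ⁻¹ * ∫ w, pd1 (ellGrad B i) j w * ∑ k, ∑ l, a k l * pd2 u k l (z + τ • w)))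
    (g' := fun τ => L * N * V * (ω (Q * τ) / (Q * τ) * Q)) ?_ ?_ ?_ ?_
  · simpa using key
  · refine ContinuousOn.mul continuousOn_const
      ((continuousOn_integral_div_self hR hdini).comp (by fun_prop) fun τ hτ => ?_)
    exact ⟨mul_nonneg hQ.le hτ.1, (mul_le_mul_of_nonneg_left hτ.2 hQ.le).trans hsR⟩
  · exact fun τ hτ => h.hasDerivAt_average hlam hQ.le hlQ hu huc i j z hτ.1
  · intro τ hτ
    have h1 := hω.hasDerivAt_integral_div_self hdini
      (r := Q * τ) ⟨mul_pos hQ hτ.1, (mul_lt_mul_of_pos_left hτ.2 hQ).trans_le hsR⟩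
    have h2 : HasDerivAt (fun τ => Q * τ) Q τ := by simpa using (hasDerivAt_id τ).const_mul Q
    exact (h1.comp τ h2).const_mul _
  · intro τ hτ
    have hτ0 := hτ.1
    have hτR : Q * τ ≤ R := (mul_le_mul_of_nonneg_left hτ.2.le hQ.le).trans hsR
    have h3 := abs_integral_mul_le_of_integral_eq_zero (continuous_pd1_ellGrad B i j)
      (fun w => pd1_eq_zero_of_notMem (h.ellGrad_eq_zero hlam hQ.le hlQ i) j)
      (h.integral_pd1_ellGrad hlam hQ.le hlQ i j)
      (fun w hw => hL.pd1_grad B h.norm_le w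
        (closedBall_subset_closedBall (by linarith) hw) i j)
      ((continuous_sum_mul_pd2 hu a).comp (by fun_prop : Continuous fun w => z + τ • w))
      (c := ∑ k, ∑ l, a k l * pd2 u k l z) (m := N * ω (Q * τ)) (fun w hw => by
        have hw' : ‖τ • w‖ ≤ Q * τ := by
          rw [norm_smul, Real.norm_of_nonneg hτ0.le, mul_comm]
          exact mul_le_mul_of_nonneg_right (by simpa using hw) hτ0.le
        refine (hN (τ • w) (hw'.trans (mul_le_mul_of_nonneg_left hτ.2.le hQ.le))).trans ?_
        exact mul_le_mul_of_nonneg_left (hω.mono ⟨norm_nonneg _, hw'.trans hτR⟩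
          ⟨by positivity, hτR⟩ hw') hN0)
    rw [abs_neg, abs_mul, abs_of_pos (inv_pos.mpr hτ0)]
    refine (mul_le_mul_of_nonneg_left h3 (inv_nonneg.mpr hτ0.le)).trans (le_of_eq ?_)
    simp only [V]
    field_simp

/-- At positive scales, the averages of `∂ᵢ∂ⱼu` around two points are compared by moving up to a
fixed scale. -/
lemma IsEllInverse.abs_average_sub_average_le (h : IsEllInverse a B b lam) (hlam : 0 < lam)
    (hQ : 0 < Q) (hlQ : 2 ≤ lam * Q ^ 2) (hL : EllKernelBound n b (3 * Q) L) (hω : IsOsc ω R)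
    (hL0 : 0 ≤ L) (hN0 : 0 ≤ N) (hu : ContDiff ℝ 2 u) (huc : HasCompactSupport u) (i j : Fin n)
    {x y : EuclideanSpace ℝ (Fin n)} {s₀ M : ℝ} (hxy : 0 < ‖x - y‖) (hs₀ : ‖x - y‖ ≤ Q * s₀)
    (hsR : 2 * Q * s₀ < R)
    (hN : ∀ w : EuclideanSpace ℝ (Fin n), ‖w‖ ≤ 2 * Q * s₀ →
      |∑ k, ∑ l, a k l * pd2 u k l (y + w) - ∑ k, ∑ l, a k l * pd2 u k l y| ≤ N * ω ‖w‖)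
    (hM : ∀ w : EuclideanSpace ℝ (Fin n), ‖w‖ ≤ Q * s₀ →
      |pd1 u j (x + w) - pd1 u j (y + w)| ≤ M) :
    |(∫ w, ellBump B w * pd2 u i j (x + (‖x - y‖ / Q) • w)) -
        ∫ w, ellBump B w * pd2 u i j (y + (‖x - y‖ / Q) • w)| ≤
      s₀⁻¹ * (L * M * volume.real (closedBall (0 : EuclideanSpace ℝ (Fin n)) Q)) +
      2 * Q * L * N * volume.real (closedBall (0 : EuclideanSpace ℝ (Fin n)) (2 * Q)) *
        (‖x - y‖ * ∫ t in ‖x - y‖..R, ω t / t ^ 2) := by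
  set V := volume.real (closedBall (0 : EuclideanSpace ℝ (Fin n)) Q)
  set W := volume.real (closedBall (0 : EuclideanSpace ℝ (Fin n)) (2 * Q))
  set r := ‖x - y‖ with hr
  have hs0 : 0 < s₀ := pos_of_mul_pos_right (hxy.trans_le hs₀) hQ.le
  have hss : r / Q ≤ s₀ := by rwa [div_le_iff₀ hQ, mul_comm]
  have hs : 0 < r / Q := by positivity
  have hrR : r < R := by nlinarith
  have hcφ := hasCompactSupport_of_eq_zero (h.ellBump_eq_zero hlam hQ.le hlQ)
  have hF := fun z => continuous_integral_mul_comp_add_smul (contDiff_ellBump B).continuous hcφ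
    (continuous_pd2 hu i j) (hasCompactSupport_pd2 huc i j) z
  set F : EuclideanSpace ℝ (Fin n) → ℝ → ℝ :=
    fun z σ => ∫ w, ellBump B w * pd2 u i j (z + σ • w)
  have hk := continuous_pd1_ellGrad B i j
  set k := pd1 (ellGrad B i) j with hkdef
  set f : EuclideanSpace ℝ (Fin n) → ℝ := fun x => ∑ k, ∑ l, a k l * pd2 u k l x with hf
  have hfc : Continuous f := continuous_sum_mul_pd2 hu a
  have hk0 : ∀ w, w ∉ closedBall 0 Q → k w = 0 := fun w hw =>
    pd1_eq_zero_of_notMem (h.ellGrad_eq_zero hlam hQ.le hlQ i) j hw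
  have hkc : HasCompactSupport k := hasCompactSupport_of_eq_zero hk0
  have hkint := h.integral_pd1_ellGrad hlam hQ.le hlQ i j
  have hend : |F x s₀ - F y s₀| ≤ s₀⁻¹ * (L * M * V) := by
    have hφ1 : ContDiff ℝ 1 (ellBump B) := (contDiff_ellBump B).of_le (by norm_num)
    have hp := (contDiff_pd1 (m := 1) hu j).continuous
    have hcb : Continuous (pd1 (ellBump B) i) :=
      (contDiff_pd1 (m := 2) (contDiff_ellBump B) i).continuous
    have hI : ∀ z, Integrable fun w => pd1 (ellBump B) i w * pd1 u j (z + s₀ • w) := fun z =>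
      (hcb.mul (hp.comp (by fun_prop))).integrable_of_hasCompactSupport
        (hasCompactSupport_pd1 hcφ i).mul_right
    have e : F x s₀ - F y s₀ = -(s₀⁻¹ *
        ∫ w, pd1 (ellBump B) i w * (pd1 u j (x + s₀ • w) - pd1 u j (y + s₀ • w))) := by
      simp only [F]
      rw [integral_mul_pd2_comp_add_smul hφ1 hcφ hu i j x hs0.ne',
        integral_mul_pd2_comp_add_smul hφ1 hcφ hu i j y hs0.ne']
      simp_rw [mul_sub]
      rw [integral_sub (hI x) (hI y)]
      ring
    rw [e, abs_neg, abs_mul, abs_of_pos (inv_pos.mpr hs0)]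
    refine mul_le_mul_of_nonneg_left (abs_integral_le_of_abs_le (fun w hw => ?_) fun w hw => ?_)
      (inv_nonneg.mpr hs0.le)
    · rw [pd1_eq_zero_of_notMem (h.ellBump_eq_zero hlam hQ.le hlQ) i hw, zero_mul]
    · rw [abs_mul]
      refine mul_le_mul (hL.pd1_bump B h.norm_le w
        (closedBall_subset_closedBall (by linarith) hw) i) (hM _ ?_) (abs_nonneg _) hL0
      rw [norm_smul, Real.norm_of_nonneg hs0.le, mul_comm]
      exact mul_le_mul_of_nonneg_right (by simpa using hw) hs0.le
  have hmid : |(F x s₀ - F y s₀) - (F x (r / Q) - F y (r / Q))| ≤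
      2 * Q * L * N * W * (r * ∫ t in r..R, ω t / t ^ 2) := by
    have hG : ∀ τ ∈ Icc (r / Q) s₀, HasDerivAt
        (fun τ => 2 * Q * L * N * W * (r * ∫ t in r..2 * Q * τ, ω t / t ^ 2))
        (2 * Q * L * N * W * (r * (ω (2 * Q * τ) / (2 * Q * τ) ^ 2 * (2 * Q)))) τ := by
      intro τ hτ
      have h1 := hω.hasDerivAt_integral_div_sq (a := r) ⟨hxy, hrR⟩ (r := 2 * Q * τ)
        ⟨mul_pos (by positivity) (hs.trans_le hτ.1),
          (mul_le_mul_of_nonneg_left hτ.2 (by positivity)).trans_lt hsR⟩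
      have h2 : HasDerivAt (fun τ => 2 * Q * τ) (2 * Q) τ := by
        simpa using (hasDerivAt_id τ).const_mul (2 * Q)
      exact ((h1.comp τ h2).const_mul r).const_mul _
    have key := abs_sub_le_of_abs_deriv_le hss ((hF x).sub (hF y)).continuousOn
      (g := fun τ => 2 * Q * L * N * W * (r * ∫ t in r..2 * Q * τ, ω t / t ^ 2))
      (f' := fun τ => -(τ⁻¹ * ∫ w, k w * f (x + τ • w)) - -(τ⁻¹ * ∫ w, k w * f (y + τ • w)))
      (g' := fun τ => 2 * Q * L * N * W *
        (r * (ω (2 * Q * τ) / (2 * Q * τ) ^ 2 * (2 * Q)))) ?_ ?_ ?_ ?_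
    · refine key.trans ?_
      have hc0 : 0 ≤ 2 * Q * L * N * W := by positivity
      have h1 : 0 ≤ ∫ t in r..2 * Q * (r / Q), ω t / t ^ 2 := by
        have e : 2 * Q * (r / Q) = 2 * r := by field_simp
        rw [e]
        refine intervalIntegral.integral_nonneg (by linarith) fun t ht => ?_
        exact div_nonneg (hω.nonneg (hxy.le.trans ht.1) (by nlinarith [ht.2])) (sq_nonneg t)
      have h2 := hω.integral_div_sq_le hxy (by linarith : r ≤ 2 * Q * s₀) hsR.le
      have h3 : r * (∫ t in r..2 * Q * s₀, ω t / t ^ 2) ≤ r * ∫ t in r..R, ω t / t ^ 2 :=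
        mul_le_mul_of_nonneg_left h2 hxy.le
      have h4 := mul_le_mul_of_nonneg_left h3 hc0
      have h5 : 0 ≤ 2 * Q * L * N * W * (r * ∫ t in r..2 * Q * (r / Q), ω t / t ^ 2) := by
        positivity
      linarith
    · exact fun τ hτ => (hG τ hτ).continuousAt.continuousWithinAt
    · exact fun τ hτ => (h.hasDerivAt_average hlam hQ.le hlQ hu huc i j x (hs.trans hτ.1)).sub
        (h.hasDerivAt_average hlam hQ.le hlQ hu huc i j y (hs.trans hτ.1))
    · exact fun τ hτ => hG τ (Ioo_subset_Icc_self hτ)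
    · intro τ hτ
      have hτ0 : 0 < τ := hs.trans hτ.1
      have hητ : r ≤ Q * τ := by
        have := hτ.1.le
        rwa [div_le_iff₀ hQ, mul_comm] at this
      set η := τ⁻¹ • (x - y) with hη
      have hηn : ‖η‖ = r / τ := by
        rw [hη, norm_smul, norm_inv, Real.norm_of_nonneg hτ0.le, hr]
        field_simp
      have hηQ : ‖η‖ ≤ Q := by rwa [hηn, div_le_iff₀ hτ0]
      have hτs : 2 * Q * τ ≤ 2 * Q * s₀ := mul_le_mul_of_nonneg_left hτ.2.le (by positivity)
      have e1 : ∫ w, k w * f (x + τ • w) = ∫ w, k (w - η) * f (y + τ • w) := by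
        rw [← integral_add_right_eq_self (fun w => k (w - η) * f (y + τ • w)) η]
        congr 1; ext w
        rw [add_sub_cancel_right, smul_add, hη, smul_inv_smul₀ hτ0.ne']
        congr 2
        abel
      have hks : Continuous fun w => k (w - η) := hk.comp (by fun_prop)
      have hk2 : ∀ w, w ∉ closedBall 0 (2 * Q) → k (w - η) = 0 := fun w hw => hk0 _ fun hw' => hw <| by
        rw [mem_closedBall_zero_iff] at hw' ⊢
        linarith [norm_le_norm_sub_add w η]
      have hk3 : ∀ w, w ∉ closedBall 0 (2 * Q) → k w = 0 := fun w hw =>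
        hk0 w fun hw' => hw (closedBall_subset_closedBall (by linarith) hw')
      have hkd : Continuous fun w => k (w - η) - k w := hks.sub hk
      have hI1 : Integrable fun w => k (w - η) :=
        hks.integrable_of_hasCompactSupport (hasCompactSupport_of_eq_zero hk2)
      have hI2 : Integrable k := hk.integrable_of_hasCompactSupport hkc
      have hfy : Continuous fun w => f (y + τ • w) := hfc.comp (by fun_prop)
      have e2 : -(τ⁻¹ * ∫ w, k w * f (x + τ • w)) - -(τ⁻¹ * ∫ w, k w * f (y + τ • w)) =
          -(τ⁻¹ * ∫ w, (k (w - η) - k w) * f (y + τ • w)) := by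
        have hJ1 : Integrable fun w => k (w - η) * f (y + τ • w) :=
          (hks.mul hfy).integrable_of_hasCompactSupport
            (hasCompactSupport_of_eq_zero hk2).mul_right
        have hJ2 : Integrable fun w => k w * f (y + τ • w) :=
          (hk.mul hfy).integrable_of_hasCompactSupport hkc.mul_right
        simp_rw [sub_mul]
        rw [e1, integral_sub hJ1 hJ2]
        ring
      have h3 := abs_integral_mul_le_of_integral_eq_zero hkd
        (fun w hw => by rw [hk2 w hw, hk3 w hw, sub_zero])
        (by rw [integral_sub hI1 hI2, integral_sub_right_eq_self, sub_self])
        (L := L * (r / τ)) (fun w hw => by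
          rw [mem_closedBall_zero_iff] at hw
          have := hL.pd1_grad_sub B h.norm_le (w - η)
            (by rw [mem_closedBall_zero_iff]; linarith [_root_.norm_sub_le w η]) w
            (by rw [mem_closedBall_zero_iff]; linarith) i j
          rwa [sub_sub_cancel_left, norm_neg, hηn] at this)
        hfy (c := f y) (m := N * ω (2 * Q * τ)) (fun w hw => by
          have hw' : ‖τ • w‖ ≤ 2 * Q * τ := by
            rw [norm_smul, Real.norm_of_nonneg hτ0.le, mul_comm]
            exact mul_le_mul_of_nonneg_right (by simpa using hw) hτ0.le
          refine (hN (τ • w) (hw'.trans hτs)).trans ?_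
          exact mul_le_mul_of_nonneg_left (hω.mono ⟨norm_nonneg _, by linarith⟩
            ⟨by positivity, by linarith⟩ hw') hN0)
      rw [e2, abs_neg, abs_mul, abs_of_pos (inv_pos.mpr hτ0)]
      refine (mul_le_mul_of_nonneg_left h3 (inv_nonneg.mpr hτ0.le)).trans (le_of_eq ?_)
      simp only [W]
      field_simp
  have := abs_sub_abs_le_abs_sub (F x (r / Q) - F y (r / Q)) (F x s₀ - F y s₀)
  rw [abs_sub_comm] at hmid
  simp only [F] at *
  linarith

/-- The averages around a fixed point depend on the coefficients in a Lipschitz way. -/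
lemma abs_average_sub_average_of_operators_le {a' : Fin n → Fin n → ℝ}
    {B' : EuclideanSpace ℝ (Fin n) →L[ℝ] EuclideanSpace ℝ (Fin n)}
    (h : IsEllInverse a B b lam) (h' : IsEllInverse a' B' b lam) (hlam : 0 < lam)
    (hQ : 0 < Q) (hlQ : 2 ≤ lam * Q ^ 2) (hL : EllKernelBound n b (3 * Q) L) (hL0 : 0 ≤ L)
    (hu : ContDiff ℝ 2 u) (i j : Fin n) {z : EuclideanSpace ℝ (Fin n)} {s D M : ℝ} (hs : 0 ≤ s)
    (hD : ‖B - B'‖ ≤ D) (hM : ∀ w : EuclideanSpace ℝ (Fin n), ‖w‖ ≤ Q * s →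
      |pd2 u i j (z + w)| ≤ M) :
    |(∫ w, ellBump B w * pd2 u i j (z + s • w)) - ∫ w, ellBump B' w * pd2 u i j (z + s • w)| ≤
      L * D * M * volume.real (closedBall (0 : EuclideanSpace ℝ (Fin n)) Q) := by
  have hI : ∀ {a : Fin n → Fin n → ℝ}
      {B : EuclideanSpace ℝ (Fin n) →L[ℝ] EuclideanSpace ℝ (Fin n)}, IsEllInverse a B b lam →
      Integrable fun w => ellBump B w * pd2 u i j (z + s • w) := fun h =>
    ((contDiff_ellBump _).continuous.mul
      ((continuous_pd2 hu i j).comp (by fun_prop))).integrable_of_hasCompactSupport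
      (hasCompactSupport_of_eq_zero (h.ellBump_eq_zero hlam hQ.le hlQ)).mul_right
  rw [← integral_sub (hI h) (hI h')]
  refine abs_integral_le_of_abs_le (fun w hw => ?_) fun w hw => ?_
  · rw [h.ellBump_eq_zero hlam hQ.le hlQ w hw, h'.ellBump_eq_zero hlam hQ.le hlQ w hw]
    simp
  · rw [← sub_mul, abs_mul]
    refine mul_le_mul ((hL.bump_sub B B' h.norm_le h'.norm_le w
      (closedBall_subset_closedBall (by linarith) hw)).trans
      (mul_le_mul_of_nonneg_left hD hL0)) (hM _ ?_) (abs_nonneg _)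
      (mul_nonneg hL0 ((norm_nonneg _).trans hD))
    rw [norm_smul, Real.norm_of_nonneg hs, mul_comm]
    exact mul_le_mul_of_nonneg_right (by simpa using hw) hs

lemma mul_abs_pd2_sub_le {ax ay : Fin n → Fin n → ℝ}
    {Bx By : EuclideanSpace ℝ (Fin n) →L[ℝ] EuclideanSpace ℝ (Fin n)}
    (hx : IsEllInverse ax Bx b lam) (hy : IsEllInverse ay By b lam) (hlam : 0 < lam)
    (hQ : 0 < Q) (hlQ : 2 ≤ lam * Q ^ 2) (hL : EllKernelBound n b (3 * Q) L) (hω : IsOsc ω R)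
    (hdini : IntegrableOn (fun s => ω s / s) (Ioc 0 R)) (hL0 : 0 ≤ L) (hN0 : 0 ≤ N)
    (hu : ContDiff ℝ 2 u) (huc : HasCompactSupport u) (i j : Fin n)
    {x y : EuclideanSpace ℝ (Fin n)} {s₀ D M M' c : ℝ} (hxy : 0 < ‖x - y‖)
    (hs₀ : ‖x - y‖ ≤ Q * s₀) (hsR : 2 * Q * s₀ < R) (hD : ‖Bx - By‖ ≤ D)
    (hc : c ≤ ∫ w, ellBump By w)
    (hNx : ∀ w : EuclideanSpace ℝ (Fin n), ‖w‖ ≤ 2 * Q * s₀ →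
      |∑ k, ∑ l, ax k l * pd2 u k l (x + w) - ∑ k, ∑ l, ax k l * pd2 u k l x| ≤ N * ω ‖w‖)
    (hNy : ∀ w : EuclideanSpace ℝ (Fin n), ‖w‖ ≤ 2 * Q * s₀ →
      |∑ k, ∑ l, ay k l * pd2 u k l (y + w) - ∑ k, ∑ l, ay k l * pd2 u k l y| ≤ N * ω ‖w‖)
    (hM : ∀ w : EuclideanSpace ℝ (Fin n), ‖w‖ ≤ Q * s₀ → |pd2 u i j (x + w)| ≤ M)
    (hM' : ∀ w : EuclideanSpace ℝ (Fin n), ‖w‖ ≤ Q * s₀ →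
      |pd1 u j (x + w) - pd1 u j (y + w)| ≤ M') :
    c * |pd2 u i j x - pd2 u i j y| ≤
      2 * (L * D * M * volume.real (closedBall (0 : EuclideanSpace ℝ (Fin n)) Q)) +
      2 * (L * N * volume.real (closedBall (0 : EuclideanSpace ℝ (Fin n)) Q) *
        ∫ t in (0 : ℝ)..‖x - y‖, ω t / t) +
      (s₀⁻¹ * (L * M' * volume.real (closedBall (0 : EuclideanSpace ℝ (Fin n)) Q)) +
      2 * Q * L * N * volume.real (closedBall (0 : EuclideanSpace ℝ (Fin n)) (2 * Q)) *
        (‖x - y‖ * ∫ t in ‖x - y‖..R, ω t / t ^ 2)) := by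
  have hs : 0 ≤ ‖x - y‖ / Q := by positivity
  have hQs : Q * (‖x - y‖ / Q) = ‖x - y‖ := by field_simp
  have hA : ∀ {a : Fin n → Fin n → ℝ} {B : EuclideanSpace ℝ (Fin n) →L[ℝ] EuclideanSpace ℝ (Fin n)}
      {z : EuclideanSpace ℝ (Fin n)}, IsEllInverse a B b lam →
      (∀ w : EuclideanSpace ℝ (Fin n), ‖w‖ ≤ 2 * Q * s₀ →
      |∑ k, ∑ l, a k l * pd2 u k l (z + w) - ∑ k, ∑ l, a k l * pd2 u k l z| ≤ N * ω ‖w‖) → _ :=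
    fun h hN => h.abs_average_sub_average_zero_le hlam hQ hlQ hL hω hdini hN0 hu huc i j _ hs
      (by linarith) (fun w hw => hN w (by linarith))
  have h1 := hA hx hNx
  have h2 := hA hy hNy
  rw [hQs] at h1 h2
  have h3 := hy.abs_average_sub_average_le hlam hQ hlQ hL hω hL0 hN0 hu huc i j hxy hs₀ hsR hNy hM'
  have h4 := abs_average_sub_average_of_operators_le hx hy hlam hQ hlQ hL hL0 hu i j (z := x)
    hs hD (fun w hw => hM w (by linarith))
  have h5 := abs_average_sub_average_of_operators_le hx hy hlam hQ hlQ hL hL0 hu i j (z := x)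
    le_rfl hD (fun w hw => hM w (by rw [mul_zero] at hw; linarith))
  have e : ∀ z, ∫ w, ellBump By w * pd2 u i j (z + (0 : ℝ) • w) =
      (∫ w, ellBump By w) * pd2 u i j z := by
    intro z
    simp only [zero_smul, add_zero]
    rw [integral_mul_const]
  have h6 : c * |pd2 u i j x - pd2 u i j y| ≤
      |(∫ w, ellBump By w) * pd2 u i j x - (∫ w, ellBump By w) * pd2 u i j y| := by
    rw [← mul_sub, abs_mul]
    exact mul_le_mul_of_nonneg_right (hc.trans (le_abs_self _)) (abs_nonneg _)
  rw [← e, ← e] at h6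
  refine h6.trans ?_
  rw [abs_le] at h1 h2 h3 h4 h5 ⊢
  constructor <;> linarith [h1.1, h1.2, h2.1, h2.2, h3.1, h3.2, h4.1, h4.2, h5.1, h5.2]

end AverageEstimates

section OscillationSpaces

variable {n : ℕ} {K : Set (EuclideanSpace ℝ (Fin n))} {f g : EuclideanSpace ℝ (Fin n) → ℝ}
  {ω : ℝ → ℝ} {R : ℝ}

lemma oscf_congr (h : EqOn f g K) : oscf K f = oscf K g := by
  ext r
  unfold oscf
  congr 1; ext d
  constructor
  · rintro ⟨x, hx, y, hy, h1, h2, rfl⟩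
    exact ⟨x, hx, y, hy, h1, h2, by rw [h hx, h hy]⟩
  · rintro ⟨x, hx, y, hy, h1, h2, rfl⟩
    exact ⟨x, hx, y, hy, h1, h2, by rw [h hx, h hy]⟩

lemma semiSet_congr (h : EqOn f g K) : semiSet K ω R f = semiSet K ω R g := by
  unfold semiSet
  rw [oscf_congr h]

lemma domSemi_congr (h : EqOn f g K) : domSemi K ω R f = domSemi K ω R g := by
  unfold domSemi
  rw [semiSet_congr h]

lemma MemD_congr (h : EqOn f g K) : MemD K ω R f ↔ MemD K ω R g := by
  unfold MemD
  rw [semiSet_congr h, continuousOn_congr h]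

lemma oscf_nonneg (K : Set (EuclideanSpace ℝ (Fin n))) (f : EuclideanSpace ℝ (Fin n) → ℝ)
    (r : ℝ) : 0 ≤ oscf K f r := by
  refine Real.sSup_nonneg ?_
  rintro _ ⟨x, -, y, -, -, -, rfl⟩
  exact abs_nonneg _

lemma domSemi_nonneg (hω : ∀ r ∈ Ioo 0 R, 0 ≤ ω r) : 0 ≤ domSemi K ω R f := by
  refine Real.sSup_nonneg ?_
  rintro _ ⟨r, hr, rfl⟩
  exact div_nonneg (oscf_nonneg K f r) (hω r hr)

lemma MemD.abs_sub_le (hf : MemD K ω R f) (hK : IsCompact K) (hω : ∀ r ∈ Ioo 0 R, 0 < ω r)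
    {x y : EuclideanSpace ℝ (Fin n)} (hx : x ∈ K) (hy : y ∈ K) (h0 : 0 < dist x y)
    (hR : dist x y < R) : |f x - f y| ≤ domSemi K ω R f * ω (dist x y) := by
  obtain ⟨D, hD⟩ := hK.exists_bound_of_continuousOn hf.1
  have h1 : |f x - f y| ≤ oscf K f (dist x y) := by
    refine le_csSup ⟨D + D, ?_⟩ ⟨x, hx, y, hy, h0, le_rfl, rfl⟩
    rintro _ ⟨z, hz, z', hz', -, -, rfl⟩
    exact (abs_sub _ _).trans (add_le_add (hD z hz) (hD z' hz'))
  have h2 : oscf K f (dist x y) / ω (dist x y) ≤ domSemi K ω R f :=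
    le_csSup hf.2 ⟨_, ⟨h0, hR⟩, rfl⟩
  rw [div_le_iff₀ (hω _ ⟨h0, hR⟩)] at h2
  exact h1.trans h2

lemma mem_upperBounds_semiSet_of_abs_sub_le {N : ℝ} (hN : 0 ≤ N)
    (hω : ∀ r ∈ Ioo 0 R, 0 ≤ ω r) (hmono : MonotoneOn ω (Icc 0 R))
    (h : ∀ x ∈ K, ∀ y ∈ K, 0 < dist x y → dist x y < R → |f x - f y| ≤ N * ω (dist x y)) :
    N ∈ upperBounds (semiSet K ω R f) := by
  rintro _ ⟨r, hr, rfl⟩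
  refine div_le_of_le_mul₀ (hω r hr) hN (Real.sSup_le ?_ (mul_nonneg hN (hω r hr)))
  rintro _ ⟨x, hx, y, hy, h0, hxy, rfl⟩
  refine (h x hx y hy h0 (hxy.trans_lt hr.2)).trans (mul_le_mul_of_nonneg_left ?_ hN)
  exact hmono ⟨h0.le, hxy.trans hr.2.le⟩ ⟨hr.1.le, hr.2.le⟩ hxy

lemma c2norm_nonneg (K : Set (EuclideanSpace ℝ (Fin n))) (u : EuclideanSpace ℝ (Fin n) → ℝ) :
    0 ≤ c2norm K u := by
  refine Real.sSup_nonneg ?_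
  rintro _ ⟨x, -, rfl⟩
  positivity

lemma norm_fderiv_fderiv_le_c2norm {u : EuclideanSpace ℝ (Fin n) → ℝ} (hu : ContDiff ℝ 2 u)
    (hK : IsCompact K) {x : EuclideanSpace ℝ (Fin n)} (hx : x ∈ K) :
    ‖fderiv ℝ (fderiv ℝ u) x‖ ≤ c2norm K u := by
  have h1 : ContDiff ℝ 1 (fderiv ℝ u) := hu.fderiv_right (by norm_num)
  have hc : Continuous fun x => |u x| + ‖fderiv ℝ u x‖ + ‖fderiv ℝ (fderiv ℝ u) x‖ :=
    (hu.continuous.abs.add h1.continuous.norm).add (h1.continuous_fderiv (by norm_num)).norm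
  have hbdd : BddAbove {c : ℝ | ∃ x ∈ K,
      c = |u x| + ‖fderiv ℝ u x‖ + ‖fderiv ℝ (fderiv ℝ u) x‖} := by
    refine (hK.bddAbove_image hc.continuousOn).mono ?_
    rintro _ ⟨x, hx, rfl⟩
    exact mem_image_of_mem _ hx
  refine le_trans ?_ (le_csSup hbdd ⟨x, hx, rfl⟩)
  have h2 := abs_nonneg (u x)
  have h3 := norm_nonneg (fderiv ℝ u x)
  linarith

lemma abs_pd2_le_c2norm {u : EuclideanSpace ℝ (Fin n) → ℝ} (hu : ContDiff ℝ 2 u)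
    (hK : IsCompact K) {x : EuclideanSpace ℝ (Fin n)} (hx : x ∈ K) (i j : Fin n) :
    |pd2 u i j x| ≤ c2norm K u := by
  have h1 : ContDiff ℝ 1 (fderiv ℝ u) := hu.fderiv_right (by norm_num)
  rw [pd2_eq_fderiv_fderiv (h1.differentiable (by norm_num) x)]
  refine le_trans ?_ (norm_fderiv_fderiv_le_c2norm hu hK hx)
  simpa using (fderiv ℝ (fderiv ℝ u) x).le_opNorm₂ (EuclideanSpace.single i 1)
    (EuclideanSpace.single j 1)

lemma abs_pd1_sub_le_c2norm {u : EuclideanSpace ℝ (Fin n) → ℝ} (hu : ContDiff ℝ 2 u)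
    (hK : IsCompact K) (hKc : Convex ℝ K) {x y : EuclideanSpace ℝ (Fin n)} (hx : x ∈ K)
    (hy : y ∈ K) (j : Fin n) : |pd1 u j x - pd1 u j y| ≤ c2norm K u * ‖x - y‖ := by
  have h1 : ContDiff ℝ 1 (fderiv ℝ u) := hu.fderiv_right (by norm_num)
  refine le_trans ?_ (hKc.norm_image_sub_le_of_norm_fderiv_le (𝕜 := ℝ)
    (fun z _ => h1.differentiable (by norm_num) z)
    (fun z hz => norm_fderiv_fderiv_le_c2norm hu hK hz) hy hx)
  simpa [pd1] using (fderiv ℝ u x - fderiv ℝ u y).le_opNorm (EuclideanSpace.single j (1 : ℝ))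

lemma c2norm_congr {u v : EuclideanSpace ℝ (Fin n) → ℝ} (h : ∀ x ∈ K, u =ᶠ[𝓝 x] v) :
    c2norm K u = c2norm K v := by
  have e : ∀ x ∈ K, |u x| + ‖fderiv ℝ u x‖ + ‖fderiv ℝ (fderiv ℝ u) x‖ =
      |v x| + ‖fderiv ℝ v x‖ + ‖fderiv ℝ (fderiv ℝ v) x‖ := fun x hx => by
    rw [(h x hx).eq_of_nhds, (h x hx).fderiv_eq, (h x hx).fderiv.fderiv_eq]
  unfold c2norm
  congr 1; ext d
  constructor
  · rintro ⟨x, hx, rfl⟩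
    exact ⟨x, hx, e x hx⟩
  · rintro ⟨x, hx, rfl⟩
    exact ⟨x, hx, (e x hx).symm⟩

lemma pd2_congr_of_eventuallyEq {u v : EuclideanSpace ℝ (Fin n) → ℝ}
    {x : EuclideanSpace ℝ (Fin n)} (h : u =ᶠ[𝓝 x] v) (i j : Fin n) :
    pd2 u i j x = pd2 v i j x := by
  have : (fun y => fderiv ℝ u y (EuclideanSpace.single j 1)) =ᶠ[𝓝 x]
      fun y => fderiv ℝ v y (EuclideanSpace.single j 1) := by
    filter_upwards [h.fderiv (𝕜 := ℝ)] with y hy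
    rw [hy]
  unfold pd2
  rw [this.fderiv_eq]

lemma exists_contDiff_hasCompactSupport_eventuallyEq {u : EuclideanSpace ℝ (Fin n) → ℝ}
    {U : Set (EuclideanSpace ℝ (Fin n))} {r : ℝ} (hr : 0 ≤ r) (hU : IsOpen U)
    (hrU : closedBall 0 r ⊆ U) (hu : ContDiffOn ℝ 2 u U) :
    ∃ v : EuclideanSpace ℝ (Fin n) → ℝ, ContDiff ℝ 2 v ∧ HasCompactSupport v ∧
      ∀ x ∈ closedBall 0 r, v =ᶠ[𝓝 x] u := by
  obtain ⟨δ, hδ, hδU⟩ := (isCompact_closedBall (0 : EuclideanSpace ℝ (Fin n)) r)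
    |>.exists_cthickening_subset_open hU hrU
  rw [cthickening_closedBall hδ.le hr] at hδU
  let χ : ContDiffBump (0 : EuclideanSpace ℝ (Fin n)) :=
    ⟨r + δ / 2, r + δ, by positivity, by linarith⟩
  refine ⟨fun x => χ x * u x, ?_, χ.hasCompactSupport.mul_right, fun x hx => ?_⟩
  · rw [contDiff_iff_contDiffAt]
    intro x
    by_cases hx : x ∈ U
    · exact χ.contDiff.contDiffAt.mul (hu.contDiffAt (hU.mem_nhds hx))
    · have hx' : x ∉ tsupport χ := fun h => hx (hδU (by rw [add_comm]; rwa [χ.tsupport_eq] at h))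
      refine (contDiffAt_const (c := (0 : ℝ))).congr_of_eventuallyEq ?_
      filter_upwards [notMem_tsupport_iff_eventuallyEq.mp hx'] with y hy
      simp [hy]
  · have : ball (0 : EuclideanSpace ℝ (Fin n)) (r + δ / 2) ∈ 𝓝 x :=
      isOpen_ball.mem_nhds (by
        rw [mem_closedBall] at hx
        rw [mem_ball]
        linarith)
    filter_upwards [this] with y hy
    rw [χ.one_of_mem_closedBall (ball_subset_closedBall hy), one_mul]

end OscillationSpaces

section InteriorEstimate

variable {n : ℕ} {a : EuclideanSpace ℝ (Fin n) → Fin n → Fin n → ℝ} {A R : ℝ} {ω : ℝ → ℝ}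

/-- Freezing the coefficients of an operator with Lipschitz coefficients. -/
lemma abs_sum_mul_pd2_sub_le {K : Set (EuclideanSpace ℝ (Fin n))} (hK : IsCompact K)
    (hLip : ∀ x y i j, |a x i j - a y i j| ≤ A * ‖x - y‖) (hA : 0 ≤ A) (hω : IsOsc ω R)
    {u : EuclideanSpace ℝ (Fin n) → ℝ} (hu : ContDiff ℝ 2 u)
    (hLu : MemD K ω R fun x => ∑ i, ∑ j, a x i j * pd2 u i j x)
    {δ : ℝ} (hδ : ∀ s ∈ Ioo 0 δ, s ≤ ω s) {p w : EuclideanSpace ℝ (Fin n)} (hp : p ∈ K)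
    (hpw : p + w ∈ K) (hwR : ‖w‖ < R) (hwδ : ‖w‖ < δ) :
    |∑ k, ∑ l, a p k l * pd2 u k l (p + w) - ∑ k, ∑ l, a p k l * pd2 u k l p| ≤
      (domSemi K ω R (fun x => ∑ i, ∑ j, a x i j * pd2 u i j x) + n ^ 2 * A * c2norm K u) *
        ω ‖w‖ := by
  rcases (norm_nonneg w).eq_or_lt with h0 | h0
  · have : w = 0 := norm_eq_zero.mp h0.symm
    subst this
    simp [hω.zero]
  have hd : dist (p + w) p = ‖w‖ := by simp [dist_eq_norm]
  have h1 := hLu.abs_sub_le hK (fun r hr => hω.pos r hr.1 hr.2.le) hpw hp (by rwa [hd])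
    (by rwa [hd])
  rw [hd] at h1
  have h2 : |∑ k, ∑ l, (a p k l - a (p + w) k l) * pd2 u k l (p + w)| ≤
      n ^ 2 * A * c2norm K u * ω ‖w‖ := by
    calc _ ≤ ∑ _k : Fin n, ∑ _l : Fin n, A * ‖w‖ * c2norm K u := by
          refine (Finset.abs_sum_le_sum_abs _ _).trans (Finset.sum_le_sum fun k _ =>
            (Finset.abs_sum_le_sum_abs _ _).trans (Finset.sum_le_sum fun l _ => ?_))
          rw [abs_mul]
          refine mul_le_mul ?_ (abs_pd2_le_c2norm hu hK hpw k l) (abs_nonneg _) (by positivity)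
          simpa using hLip p (p + w) k l
      _ = n ^ 2 * A * c2norm K u * ‖w‖ := by simp; ring
      _ ≤ _ := mul_le_mul_of_nonneg_left (hδ _ ⟨h0, hwδ⟩)
          (mul_nonneg (by positivity) (c2norm_nonneg K u))
  have e : ∑ k, ∑ l, a p k l * pd2 u k l (p + w) - ∑ k, ∑ l, a p k l * pd2 u k l p =
      (∑ k, ∑ l, a (p + w) k l * pd2 u k l (p + w) - ∑ k, ∑ l, a p k l * pd2 u k l p) +
      ∑ k, ∑ l, (a p k l - a (p + w) k l) * pd2 u k l (p + w) := by
    simp_rw [sub_mul, Finset.sum_sub_distrib]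
    ring
  rw [e, add_mul]
  exact (abs_add_le _ _).trans (add_le_add h1 h2)

/-- The bookkeeping that collects all the error terms of `mul_abs_pd2_sub_le`. -/
lemma le_mul_add_div_mul_of_mul_le {c L β q A S M V W Q ρ r H I D T : ℝ} (hc : 0 < c) (hL : 0 ≤ L)
    (hβ : 0 ≤ β) (hq : 0 ≤ q) (hA : 0 ≤ A) (hS : 0 ≤ S) (hM : 0 ≤ M) (hV : 0 ≤ V) (hW : 0 ≤ W)
    (hQ : 0 < Q) (hρ : 0 < ρ) (hρ1 : ρ ≤ 1) (hr : 0 ≤ r) (hrH : r ≤ H) (hI : I ≤ |D| * H)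
    (key : c * T ≤ 2 * (L * (β * (q * (A * r))) * M * V) + 2 * (L * (S + q * A * M) * V * H) +
      ((ρ / (2 * Q))⁻¹ * (L * (M * r) * V) + 2 * Q * L * (S + q * A * M) * W * I)) :
    T ≤ (c⁻¹ * ((2 * L * V + 2 * Q * L * W * |D|) + (2 * (L * (β * (q * A)) * V) +
      (2 * L * V + 2 * Q * L * W * |D|) * (q * A) + 2 * Q * L * V)) + 4) * (S + M / ρ) * H := by
  have hH : 0 ≤ H := hr.trans hrH
  have hMρ : M ≤ M / ρ := by
    rw [le_div_iff₀ hρ]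
    exact mul_le_of_le_one_right hM hρ1
  have hMρ0 : 0 ≤ M / ρ := by positivity
  obtain ⟨K₁, hK₁⟩ : ∃ K, K = 2 * L * V + 2 * Q * L * W * |D| := ⟨_, rfl⟩
  rw [← hK₁]
  obtain ⟨K₂, hK₂⟩ : ∃ K, K = 2 * (L * (β * (q * A)) * V) + K₁ * (q * A) + 2 * Q * L * V := ⟨_, rfl⟩
  rw [← hK₂]
  have hK₁0 : 0 ≤ K₁ := by rw [hK₁]; positivity
  have hK₂0 : 0 ≤ K₂ := by rw [hK₂]; positivity
  have t1 : 2 * (L * (β * (q * (A * r))) * M * V) ≤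
      2 * (L * (β * (q * A)) * V) * (M / ρ) * H := by
    calc _ = 2 * (L * (β * (q * A)) * V) * M * r := by ring
      _ ≤ _ := by gcongr
  have t2 : (ρ / (2 * Q))⁻¹ * (L * (M * r) * V) ≤ 2 * Q * L * V * (M / ρ) * H := by
    calc _ = 2 * Q * L * V * (M / ρ) * r := by field_simp
      _ ≤ _ := by gcongr
  have t3 : 2 * Q * L * (S + q * A * M) * W * I ≤
      2 * Q * L * (S + q * A * (M / ρ)) * W * (|D| * H) := by
    calc _ ≤ 2 * Q * L * (S + q * A * M) * W * (|D| * H) :=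
          mul_le_mul_of_nonneg_left hI (by positivity)
      _ ≤ _ := by gcongr
  have t4 : 2 * (L * (S + q * A * M) * V * H) ≤ 2 * (L * (S + q * A * (M / ρ)) * V * H) := by
    gcongr
  have t5 : c * T ≤ (K₁ * S + K₂ * (M / ρ)) * H := by
    calc _ ≤ _ := key
      _ ≤ _ := add_le_add (add_le_add t1 t4) (add_le_add t2 t3)
      _ = _ := by rw [hK₂, hK₁]; ring
  have t6 : T ≤ c⁻¹ * ((K₁ * S + K₂ * (M / ρ)) * H) := by
    rwa [← div_eq_inv_mul, le_div_iff₀ hc, mul_comm]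
  refine t6.trans ?_
  rw [← mul_assoc]
  refine mul_le_mul_of_nonneg_right ?_ hH
  have t7 : K₁ * S + K₂ * (M / ρ) ≤ (K₁ + K₂) * (S + M / ρ) := by
    nlinarith [mul_nonneg hK₁0 hMρ0, mul_nonneg hK₂0 hS]
  calc _ ≤ c⁻¹ * ((K₁ + K₂) * (S + M / ρ)) := by gcongr
    _ = c⁻¹ * (K₁ + K₂) * (S + M / ρ) := by ring
    _ ≤ _ := by gcongr; linarith

lemma exists_abs_pd2_sub_le (hn : 0 < n) (hsymm : ∀ x i j, a x i j = a x j i) (hA : 0 < A)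
    (hLip : ∀ x y i j, |a x i j - a y i j| ≤ A * ‖x - y‖) {ν : ℝ} (hν : 0 < ν)
    (hell : ∀ x ξ : EuclideanSpace ℝ (Fin n), ν * ‖ξ‖ ^ 2 ≤ ∑ i, ∑ j, a x i j * ξ i * ξ j)
    (hR : 0 < R) (hω : IsOsc ω R) (hdini : IntegrableOn (fun s => ω s / s) (Ioc 0 R))
    {δ : ℝ} (hδ0 : 0 < δ) (hδ : ∀ s ∈ Ioo 0 δ, s ≤ ω s) {C₂ δ₂ : ℝ} (hδ₂ : 0 < δ₂)
    (hB : ∀ r ∈ Ioo 0 δ₂, (r * ∫ s in r..R, ω s / s ^ 2) ≤ C₂ * ∫ s in (0 : ℝ)..r, ω s / s) :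
    ∃ C ρ₀ : ℝ, 0 < C ∧ 0 < ρ₀ ∧ ∀ ρ, 0 < ρ → ρ ≤ ρ₀ →
      ∀ u : EuclideanSpace ℝ (Fin n) → ℝ, ContDiff ℝ 2 u → HasCompactSupport u →
      MemD (closedBall 0 (2 * ρ)) ω R (fun x => ∑ i, ∑ j, a x i j * pd2 u i j x) →
      ∀ i j, ∀ x ∈ closedBall 0 ρ, ∀ y ∈ closedBall 0 ρ, 0 < ‖x - y‖ →
        |pd2 u i j x - pd2 u i j y| ≤
          C * (domSemi (closedBall 0 (2 * ρ)) ω R (fun x => ∑ i, ∑ j, a x i j * pd2 u i j x) +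
            c2norm (closedBall 0 (2 * ρ)) u / ρ) * ∫ s in (0 : ℝ)..‖x - y‖, ω s / s := by
  have hn' : (0 : ℝ) < n := by exact_mod_cast hn
  obtain ⟨m, hm0, hm⟩ : ∃ m : ℝ, 0 < m ∧
      ∀ x ∈ closedBall (0 : EuclideanSpace ℝ (Fin n)) 1, ∀ k l, |a x k l| ≤ m := by
    refine ⟨A + ∑ k, ∑ l, |a 0 k l|, by positivity, fun x hx k l => ?_⟩
    have h1 : |a 0 k l| ≤ ∑ k, ∑ l, |a 0 k l| :=
      (Finset.single_le_sum (f := fun l => |a 0 k l|) (fun _ _ => abs_nonneg _)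
        (Finset.mem_univ l)).trans (Finset.single_le_sum (f := fun k => ∑ l, |a 0 k l|)
          (fun _ _ => Finset.sum_nonneg fun _ _ => abs_nonneg _) (Finset.mem_univ k))
    have h2 := hLip x 0 k l
    rw [sub_zero] at h2
    have h3 : A * ‖x‖ ≤ A * 1 := mul_le_mul_of_nonneg_left (by simpa using hx) hA.le
    have h4 := abs_sub_abs_le_abs_sub (a x k l) (a 0 k l)
    linarith
  have hnm : 0 < (n : ℝ) ^ 2 * m := by positivity
  set lam := ν / (n ^ 2 * m) ^ 2
  have hlam : 0 < lam := by positivity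
  have hinv : ∀ x ∈ closedBall (0 : EuclideanSpace ℝ (Fin n)) 1,
      ∃ B, IsEllInverse (a x) B ν⁻¹ lam := fun x hx =>
    exists_isEllInverse (hsymm x) hν (hell x) hnm (hm x hx)
  obtain ⟨Q, hQ, hlQ⟩ : ∃ Q : ℝ, 0 < Q ∧ 2 ≤ lam * Q ^ 2 := by
    refine ⟨1 + 2 / lam, by positivity, ?_⟩
    have : lam * (1 + 2 / lam) ^ 2 = lam + 4 + 4 / lam := by field_simp; ring
    have h2 : 0 < 4 / lam := by positivity
    linarith
  obtain ⟨L, hL0, hL⟩ := exists_ellKernelBound n ν⁻¹ (3 * Q)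
  obtain ⟨c, hc0, hc⟩ := exists_pos_le_integral_ellBump n (inv_nonneg.mpr hν.le)
  set V := volume.real (closedBall (0 : EuclideanSpace ℝ (Fin n)) Q) with hV
  set W := volume.real (closedBall (0 : EuclideanSpace ℝ (Fin n)) (2 * Q)) with hW
  have hV0 : 0 ≤ V := measureReal_nonneg
  have hW0 : 0 ≤ W := measureReal_nonneg
  set K₁ := 2 * L * V + 2 * Q * L * W * |C₂| with hK₁
  set K₂ := 2 * (L * (ν⁻¹ ^ 2 * (n ^ 2 * A)) * V) + K₁ * (n ^ 2 * A) + 2 * Q * L * V with hK₂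
  have hK₁0 : 0 ≤ K₁ := by positivity
  have hK₂0 : 0 ≤ K₂ := by positivity
  refine ⟨c⁻¹ * (K₁ + K₂) + 4, min (min (1 / 2) (R / 3)) (min (δ / 3) (δ₂ / 3)), by positivity,
    by positivity, fun ρ hρ hρ₀ u hu huc hLu i j x hx y hy hxy => ?_⟩
  simp only [le_min_iff] at hρ₀
  obtain ⟨⟨hρ1, hρR⟩, hρδ, hρδ₂⟩ := hρ₀
  set K := closedBall (0 : EuclideanSpace ℝ (Fin n)) (2 * ρ) with hKdef
  have hK : IsCompact K := isCompact_closedBall _ _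
  have hx' : ‖x‖ ≤ ρ := by simpa using hx
  have hy' : ‖y‖ ≤ ρ := by simpa using hy
  have hxyρ : ‖x - y‖ ≤ 2 * ρ := by linarith [_root_.norm_sub_le x y]
  have hxK : x ∈ K := closedBall_subset_closedBall (by linarith) hx
  have hyK : y ∈ K := closedBall_subset_closedBall (by linarith) hy
  have hadd : ∀ p w : EuclideanSpace ℝ (Fin n), ‖p‖ ≤ ρ → ‖w‖ ≤ ρ → p + w ∈ K := fun p w hp hw => by
    rw [hKdef, mem_closedBall_zero_iff]
    linarith [norm_add_le p w]
  set S := domSemi K ω R (fun x => ∑ i, ∑ j, a x i j * pd2 u i j x)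
  set M := c2norm K u
  have hS0 : 0 ≤ S := domSemi_nonneg fun r hr => (hω.pos r hr.1 hr.2.le).le
  have hM0 : 0 ≤ M := c2norm_nonneg K u
  set r := ‖x - y‖ with hr
  set H := ∫ s in (0 : ℝ)..r, ω s / s with hH
  have hrH : r ≤ H := hω.le_integral_div_self hdini hδ hxy.le (by linarith) (by linarith)
  have hMρ0 : 0 ≤ M / ρ := by positivity
  rcases le_or_gt r (ρ / 2) with hrρ | hrρ
  · obtain ⟨Bx, hBx⟩ := hinv x (by rw [mem_closedBall_zero_iff]; linarith)
    obtain ⟨By, hBy⟩ := hinv y (by rw [mem_closedBall_zero_iff]; linarith)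
    have hQρ : 2 * Q * (ρ / (2 * Q)) = ρ := by field_simp
    have hQρ' : Q * (ρ / (2 * Q)) = ρ / 2 := by field_simp
    have hfr : ∀ p : EuclideanSpace ℝ (Fin n), ‖p‖ ≤ ρ → p ∈ K →
        ∀ w : EuclideanSpace ℝ (Fin n), ‖w‖ ≤ 2 * Q * (ρ / (2 * Q)) →
        |∑ k, ∑ l, a p k l * pd2 u k l (p + w) - ∑ k, ∑ l, a p k l * pd2 u k l p| ≤
          (S + n ^ 2 * A * M) * ω ‖w‖ := fun p hp hpK w hw => by
      rw [hQρ] at hw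
      exact abs_sum_mul_pd2_sub_le hK hLip hA.le hω hu hLu hδ hpK (hadd p w hp hw)
        (by linarith) (by linarith)
    have key := mul_abs_pd2_sub_le hBx hBy hlam hQ hlQ hL hω hdini hL0
      (by positivity : 0 ≤ S + n ^ 2 * A * M) hu huc i j (s₀ := ρ / (2 * Q)) (M := M)
      (M' := M * r) hxy (by linarith) (by linarith)
      (hBx.norm_sub_le hBy (hLip x y) (by positivity))
      (hc By hBy.norm_le (hasCompactSupport_of_eq_zero (hBy.ellBump_eq_zero hlam hQ.le hlQ)))
      (hfr x hx' hxK) (hfr y hy' hyK)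
      (fun w hw => abs_pd2_le_c2norm hu hK (hadd x w hx' (by linarith)) i j)
      (fun w hw => by
        have := abs_pd1_sub_le_c2norm hu hK (convex_closedBall _ _) (hadd x w hx' (by linarith))
          (hadd y w hy' (by linarith)) j
        rwa [add_sub_add_right_eq_sub] at this)
    rw [← hr, ← hV, ← hW, ← hH] at key
    have hBr : (r * ∫ s in r..R, ω s / s ^ 2) ≤ |C₂| * H :=
      (hB r ⟨hxy, by linarith⟩).trans
        (mul_le_mul_of_nonneg_right (le_abs_self _) (hxy.le.trans hrH))
    have hH0 : 0 ≤ H := hxy.le.trans hrH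
    exact le_mul_add_div_mul_of_mul_le hc0 hL0 (by positivity) (by positivity) hA.le hS0 hM0 hV0 hW0
      hQ hρ (by linarith) hxy.le hrH hBr key
  · have h1 := abs_pd2_le_c2norm hu hK hxK i j
    have h2 := abs_pd2_le_c2norm hu hK hyK i j
    calc |pd2 u i j x - pd2 u i j y| ≤ M + M := (abs_sub _ _).trans (add_le_add h1 h2)
      _ = 4 * (M / ρ) * (ρ / 2) := by field_simp; ring
      _ ≤ (c⁻¹ * (K₁ + K₂) + 4) * (S + M / ρ) * H := by
        have h3 : 0 ≤ c⁻¹ * (K₁ + K₂) := by positivity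
        exact mul_le_mul (mul_le_mul (by linarith) (by linarith) hMρ0 (by linarith))
          (by linarith) (by positivity) (by positivity)

end InteriorEstimate

/-- Interior estimate, variable coefficients: for `L = Σ aᵢⱼ(x) ∂ᵢ∂ⱼ` uniformly elliptic with
symmetric coefficients, Lipschitz with constants bounded by `A`, and `ω` additionally
satisfying `ω ≤ k₁ ĥ` near `0`: there is `C > 0` such that for `0 < ρ ≤ 1/(2 C k₁)` and `u`
twice continuously differentiable on a neighbourhood of `I(2ρ)` with `Lu ∈ D_ω(I(2ρ))`,
one has `∇²u ∈ D_ĥ(I(ρ))` and `[∇²u]_{ĥ;ρ} ≤ C [Lu]_{ω;2ρ} + (C/ρ³) ‖u‖_{C²(I(2ρ))}`. -/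
theorem interior_estimate_variable_coeff {n : ℕ} (hn : 3 ≤ n)
    (a : EuclideanSpace ℝ (Fin n) → Fin n → Fin n → ℝ)
    (hsymm : ∀ x i j, a x i j = a x j i)
    (A : ℝ) (hA : 0 < A)
    (hLip : ∀ i j, LipschitzWith (Real.toNNReal A) (fun x => a x i j))
    (ν : ℝ) (hν : 0 < ν)
    (hell : ∀ (x : EuclideanSpace ℝ (Fin n)) (ξ : EuclideanSpace ℝ (Fin n)),
      ν * ‖ξ‖ ^ 2 ≤ ∑ i, ∑ j, a x i j * ξ i * ξ j)
    (R : ℝ) (hR : 0 < R) (ω : ℝ → ℝ) (hω : IsOsc ω R)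
    (hdini : IntegrableOn (fun s => ω s / s) (Set.Ioc 0 R))
    (hinf : Filter.Tendsto (fun r => ω r / r) (nhdsWithin 0 (Set.Ioi 0)) Filter.atTop)
    (k₁' c₁ δ₁ : ℝ) (hk₁' : 1 < k₁') (hc₁ : 0 < c₁) (hδ₁ : 0 < δ₁) (hδ₁R : k₁' * δ₁ ≤ R)
    (hdbl : ∀ r ∈ Set.Ioo (0:ℝ) δ₁, ω (k₁' * r) ≤ c₁ * ω r)
    (C₂ δ₂ : ℝ) (hδ₂ : 0 < δ₂)
    (hB : ∀ r ∈ Set.Ioo (0:ℝ) δ₂,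
      (r * ∫ s in r..R, ω s / s ^ 2) / (∫ s in (0:ℝ)..r, ω s / s) ≤ C₂)
    (k₁ δ₃ : ℝ) (hk₁ : 0 < k₁) (hδ₃ : 0 < δ₃)
    (hjunto : ∀ r ∈ Set.Ioo (0:ℝ) δ₃, ω r ≤ k₁ * ∫ s in (0:ℝ)..r, ω s / s) :
    ∃ C : ℝ, 0 < C ∧ ∀ ρ : ℝ, 0 < ρ → ρ ≤ 1 / (2 * C * k₁) →
      ∀ (u : EuclideanSpace ℝ (Fin n) → ℝ) (U : Set (EuclideanSpace ℝ (Fin n))),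
        IsOpen U → Metric.closedBall 0 (2 * ρ) ⊆ U → ContDiffOn ℝ 2 u U →
        MemD (Metric.closedBall 0 (2 * ρ)) ω R
          (fun x => ∑ i, ∑ j, a x i j * pd2 u i j x) →
        ∀ i j : Fin n,
          MemD (Metric.closedBall 0 ρ) (fun r => ∫ s in (0:ℝ)..r, ω s / s) R (pd2 u i j) ∧
          domSemi (Metric.closedBall 0 ρ) (fun r => ∫ s in (0:ℝ)..r, ω s / s) R
              (pd2 u i j) ≤
            C * domSemi (Metric.closedBall 0 (2 * ρ)) ω R
                (fun x => ∑ i, ∑ j, a x i j * pd2 u i j x) +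
              (C / ρ ^ 3) * c2norm (Metric.closedBall 0 (2 * ρ)) u := by
  obtain ⟨δ, hδ, hδω⟩ : ∃ δ > 0, ∀ s ∈ Ioo 0 δ, s ≤ ω s := by
    obtain ⟨δ, hδ, h⟩ := mem_nhdsGT_iff_exists_Ioo_subset.mp
      (hinf.eventually (eventually_ge_atTop 1))
    exact ⟨δ, hδ, fun s hs => (one_le_div hs.1).mp (h hs)⟩
  have hmono := hω.monotoneOn_integral_div_self hR.le hdini
  have hnonneg : ∀ r ∈ Ioo 0 R, 0 ≤ ∫ s in (0:ℝ)..r, ω s / s := fun r hr => by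
    simpa using hmono ⟨le_rfl, hR.le⟩ ⟨hr.1.le, hr.2.le⟩ hr.1.le
  have hB' : ∀ r ∈ Ioo 0 (min δ₂ (min R δ)),
      (r * ∫ s in r..R, ω s / s ^ 2) ≤ C₂ * ∫ s in (0:ℝ)..r, ω s / s := fun r hr => by
    obtain ⟨h0, h1⟩ := hr
    simp only [lt_min_iff] at h1
    have hpos : r ≤ ∫ s in (0:ℝ)..r, ω s / s :=
      hω.le_integral_div_self hdini hδω h0.le h1.2.1.le h1.2.2.le
    exact (div_le_iff₀ (h0.trans_le hpos)).mp (hB r ⟨h0, h1.1⟩)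
  obtain ⟨C₀, ρ₀, hC₀, hρ₀, H⟩ := exists_abs_pd2_sub_le (by omega) hsymm hA
    (fun x y i j => by
      simpa [dist_eq_norm, Real.dist_eq, hA.le] using (hLip i j).dist_le_mul x y)
    hν hell hR hω hdini hδ hδω (by positivity) hB'
  have hρ₁ : 0 < min ρ₀ 1 := lt_min hρ₀ one_pos
  refine ⟨max C₀ (1 / (2 * k₁ * min ρ₀ 1)), lt_max_of_lt_left hC₀, ?_⟩
  intro ρ hρ hρC u U hU hρU hu hLu i j
  obtain ⟨C, hC⟩ : ∃ C, C = max C₀ (1 / (2 * k₁ * min ρ₀ 1)) := ⟨_, rfl⟩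
  rw [← hC] at hρC ⊢
  have hC₀C : C₀ ≤ C := hC ▸ le_max_left _ _
  have hCpos : 0 < C := hC₀.trans_le hC₀C
  have hρ' : ρ ≤ min ρ₀ 1 := by
    have h1 : 1 / (2 * k₁ * min ρ₀ 1) ≤ C := hC ▸ le_max_right _ _
    rw [div_le_iff₀ (by positivity)] at h1
    refine hρC.trans ?_
    rw [div_le_iff₀ (by positivity)]
    linarith
  obtain ⟨v, hv, hvc, hvu⟩ :=
    exists_contDiff_hasCompactSupport_eventuallyEq (by positivity) hU hρU hu
  have hpd : ∀ k l, EqOn (pd2 v k l) (pd2 u k l) (closedBall 0 (2 * ρ)) := fun k l x hx =>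
    pd2_congr_of_eventuallyEq (hvu x hx) k l
  have hLeq : EqOn (fun x => ∑ i, ∑ j, a x i j * pd2 v i j x)
      (fun x => ∑ i, ∑ j, a x i j * pd2 u i j x) (closedBall 0 (2 * ρ)) := fun x hx =>
    Finset.sum_congr rfl fun k _ => Finset.sum_congr rfl fun l _ => by rw [hpd k l hx]
  have hpdρ := (hpd i j).mono (closedBall_subset_closedBall (by linarith : ρ ≤ 2 * ρ))
  have hest := H ρ hρ (hρ'.trans (min_le_left _ _)) v hv hvc ((MemD_congr hLeq).mpr hLu) i j
  rw [domSemi_congr hLeq, c2norm_congr hvu] at hest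
  rw [← MemD_congr hpdρ, ← domSemi_congr hpdρ]
  have hS : 0 ≤ domSemi (closedBall 0 (2 * ρ)) ω R (fun x => ∑ i, ∑ j, a x i j * pd2 u i j x) :=
    domSemi_nonneg fun r hr => (hω.pos r hr.1 hr.2.le).le
  have hM := c2norm_nonneg (closedBall 0 (2 * ρ)) u
  generalize domSemi (closedBall 0 (2 * ρ)) ω R (fun x => ∑ i, ∑ j, a x i j * pd2 u i j x) = S
    at hest hS ⊢
  generalize c2norm (closedBall 0 (2 * ρ)) u = M at hest hM ⊢
  have hN : 0 ≤ C * S + C / ρ ^ 3 * M := by positivity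
  have hle : C₀ * (S + M / ρ) ≤ C * S + C / ρ ^ 3 * M := by
    have h1 : M / ρ ≤ M / ρ ^ 3 := div_le_div_of_nonneg_left hM (by positivity)
      (pow_le_of_le_one hρ.le (hρ'.trans (min_le_right _ _)) (by norm_num))
    calc C₀ * (S + M / ρ) ≤ C * (S + M / ρ ^ 3) := by gcongr
      _ = _ := by ring
  have hub := mem_upperBounds_semiSet_of_abs_sub_le (f := pd2 v i j) (K := closedBall 0 ρ) hN
    hnonneg hmono fun x hx y hy h0 hR' => by
      rw [dist_eq_norm] at h0 hR' ⊢
      exact (hest x hx y hy h0).trans (mul_le_mul_of_nonneg_right hle (hnonneg _ ⟨h0, hR'⟩))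
  exact ⟨⟨(continuous_pd2 hv i j).continuousOn, _, hub⟩, Real.sSup_le (fun _ h => hub h) hN⟩
end

section
/- (Sharpness construction.) Let n ≥ 2 and let ω be an oscillation function, pointwise differentiable on (0, δ₁), with ∫₀^R ω(r)/r dr < ∞ and ω(r)/(r ω'(r)) ≥ C > 0 on (0, δ₁); set ĥ(r) = ∫₀^r ω(s)/s ds and define u : ℝⁿ → ℝ by u(x) = ĥ(|x|) x₁ x₂ (u(0) = 0). Then there exist a constant C' > 0 and δ > 0 such that for 0 < |x| < δ: (a) Δu(x) = (n+2) (x₁x₂/|x|²) ω(|x|) + (x₁x₂/|x|²) |x| ω'(|x|), and in particular |Δu(x) − Δu(0)| = |Δu(x)| ≤ C' ω(|x|); and (b) ∂₁∂₂u(x) = ĥ(|x|) + (1/|x|²)(x₁² + x₂² − 2 x₁²x₂²/|x|²) ω(|x|) + (x₁²x₂²/|x|⁴) |x| ω'(|x|), and in particular |∂₁∂₂u(x) − ∂₁∂₂u(0)| ≥ ĥ(|x|). Hence any regularity statement asserting that Δu ∈ D_ω near the origin implies ∇²u ∈ D_{ĥ₀} near the origin forces ĥ(r) ≤ c ĥ₀(r)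 near 0 for some constant c. -/
open Set MeasureTheory Filter Topology

section RadialQuadratic

variable {E : Type*} [NormedAddCommGroup E] [InnerProductSpace ℝ E]

/-- If `|f y| ≤ g y * ‖y‖` near `0` with `g → 0`, then `f` has zero derivative at `0`. -/
theorem hasFDerivAt_zero_of_abs_le_mul_norm {f g : E → ℝ}
    (hfg : ∀ᶠ y in 𝓝 0, |f y| ≤ g y * ‖y‖) (hg : Tendsto g (𝓝 0) (𝓝 0)) :
    HasFDerivAt f (0 : E →L[ℝ] ℝ) 0 := by
  have h0 : f 0 = 0 := by
    have := hfg.self_of_nhds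
    simpa using this
  rw [hasFDerivAt_iff_isLittleO_nhds_zero]
  simp only [zero_add, h0, sub_zero, zero_apply]
  rw [Asymptotics.isLittleO_iff]
  intro c hc
  filter_upwards [hfg, hg.eventually (gt_mem_nhds hc)] with y hy hgy
  rw [Real.norm_eq_abs]
  exact hy.trans (by gcongr)

/-- The derivative of a radial function away from the origin. -/
theorem HasDerivAt.hasFDerivAt_comp_norm {w : ℝ → ℝ} {w' : ℝ} {x : E} (hx : x ≠ 0)
    (hw : HasDerivAt w w' ‖x‖) :
    HasFDerivAt (fun y : E => w ‖y‖) ((w' / ‖x‖) • innerSL ℝ x) x := by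
  have hx' : ‖x‖ ≠ 0 := norm_ne_zero_iff.mpr hx
  have hn : HasFDerivAt (fun y : E => ‖y‖) ((1 / ‖x‖) • innerSL ℝ x) x := by
    have h := (hasStrictFDerivAt_norm_sq x).hasFDerivAt.sqrt (pow_ne_zero 2 hx')
    simp only [Real.sqrt_sq (norm_nonneg _)] at h
    convert h using 1
    ext v
    simp
    field_simp
  have h := hw.comp_hasFDerivAt x hn
  rwa [smul_smul, mul_one_div] at h

/-- The derivative of `y ↦ h(‖y‖) p(y) q(y)` in direction `v`, where `h'(r) = ω(r)/r`. -/
noncomputable def radialQuadraticDeriv (h ω : ℝ → ℝ) (p q : E →L[ℝ] ℝ) (v y : E) : ℝ :=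
  ω ‖y‖ / ‖y‖ ^ 2 * (inner ℝ y v * (p y * q y)) + h ‖y‖ * (p v * q y + p y * q v)

variable {h ω : ℝ → ℝ} {p q : E →L[ℝ] ℝ}

theorem fderiv_radialQuadratic {x : E} (hx : x ≠ 0) (hh : HasDerivAt h (ω ‖x‖ / ‖x‖) ‖x‖) (v : E) :
    fderiv ℝ (fun y => h ‖y‖ * (p y * q y)) x v = radialQuadraticDeriv h ω p q v x := by
  have hx' : ‖x‖ ≠ 0 := norm_ne_zero_iff.mpr hx
  have H := (hh.hasFDerivAt_comp_norm hx).mul (p.hasFDerivAt.mul q.hasFDerivAt)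
  have H' : HasFDerivAt (fun y => h ‖y‖ * (p y * q y)) _ x := H
  rw [H'.fderiv]
  simp [radialQuadraticDeriv]
  field_simp
  ring

theorem fderiv_radialQuadratic_zero (hh : Tendsto (fun y : E => h ‖y‖) (𝓝 0) (𝓝 0)) :
    fderiv ℝ (fun y : E => h ‖y‖ * (p y * q y)) 0 = 0 := by
  refine (hasFDerivAt_zero_of_abs_le_mul_norm
    (g := fun y => |h ‖y‖| * (‖p‖ * (‖q‖ * ‖y‖))) (Eventually.of_forall fun y => ?_) ?_).fderiv
  · rw [abs_mul, abs_mul]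
    calc |h ‖y‖| * (|p y| * |q y|) ≤ |h ‖y‖| * ((‖p‖ * ‖y‖) * (‖q‖ * ‖y‖)) := by
          gcongr
          · exact p.le_opNorm y
          · exact q.le_opNorm y
      _ = _ := by ring
  · have h1 : Tendsto (fun y : E => ‖p‖ * (‖q‖ * ‖y‖)) (𝓝 0) (𝓝 (‖p‖ * (‖q‖ * ‖(0 : E)‖))) :=
      Continuous.tendsto (by fun_prop) 0
    simpa using hh.abs.mul h1

/-- The directional derivatives of `y ↦ h(‖y‖) p(y) q(y)`, on a ball. -/
theorem eventuallyEq_fderiv_radialQuadratic {δ : ℝ}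
    (hh : ∀ r ∈ Ioo 0 δ, HasDerivAt h (ω r / r) r)
    (hh0 : Tendsto (fun y : E => h ‖y‖) (𝓝 0) (𝓝 0)) (v : E) {x : E} (hx : ‖x‖ < δ) :
    (fun y => fderiv ℝ (fun z => h ‖z‖ * (p z * q z)) y v) =ᶠ[𝓝 x]
      radialQuadraticDeriv h ω p q v := by
  filter_upwards [continuous_norm.continuousAt.eventually (gt_mem_nhds hx)] with y hy
  rcases eq_or_ne y 0 with rfl | hy0
  · rw [fderiv_radialQuadratic_zero hh0]
    simp [radialQuadraticDeriv]
  · exact fderiv_radialQuadratic hy0 (hh _ ⟨norm_pos_iff.mpr hy0, hy⟩) v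

theorem fderiv_radialQuadraticDeriv {x : E} {ω' : ℝ} (hx : x ≠ 0)
    (hh : HasDerivAt h (ω ‖x‖ / ‖x‖) ‖x‖) (hω : HasDerivAt ω ω' ‖x‖) (v w : E) :
    fderiv ℝ (radialQuadraticDeriv h ω p q v) x w =
      (ω' / ‖x‖ ^ 3 - 2 * ω ‖x‖ / ‖x‖ ^ 4) * (inner ℝ x w * inner ℝ x v * (p x * q x)) +
        ω ‖x‖ / ‖x‖ ^ 2 * (inner ℝ w v * (p x * q x) + inner ℝ x v * (p w * q x + p x * q w) +
          inner ℝ x w * (p v * q x + p x * q v)) +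
        h ‖x‖ * (p v * q w + p w * q v) := by
  have hx' : ‖x‖ ≠ 0 := norm_ne_zero_iff.mpr hx
  have hG := (hω.div (hasDerivAt_pow 2 ‖x‖) (pow_ne_zero 2 hx')).hasFDerivAt_comp_norm hx
  have hv : HasFDerivAt (fun y : E => inner ℝ y v) (innerSL ℝ v) x := by
    simpa only [innerSL_apply_apply, real_inner_comm v] using! (innerSL ℝ v).hasFDerivAt (x := x)
  have H := (hG.mul (hv.mul (p.hasFDerivAt.mul q.hasFDerivAt))).add
    ((hh.hasFDerivAt_comp_norm hx).mul
      ((q.hasFDerivAt.const_mul (p v)).add (p.hasFDerivAt.mul_const (q v))))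
  have H' : HasFDerivAt (radialQuadraticDeriv h ω p q v) _ x := H
  rw [H'.fderiv]
  simp [real_inner_comm w v]
  field_simp
  ring

theorem fderiv_radialQuadraticDeriv_zero (hh : Tendsto (fun y : E => h ‖y‖) (𝓝 0) (𝓝 0))
    (hω : Tendsto (fun y : E => ω ‖y‖) (𝓝 0) (𝓝 0)) (v : E) :
    fderiv ℝ (radialQuadraticDeriv h ω p q v) 0 = 0 := by
  refine (hasFDerivAt_zero_of_abs_le_mul_norm
    (g := fun y => (|ω ‖y‖| + 2 * |h ‖y‖|) * (‖v‖ * ‖p‖ * ‖q‖))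
    (Eventually.of_forall fun y => ?_) ?_).fderiv
  · rcases eq_or_ne y 0 with rfl | hy
    · simp [radialQuadraticDeriv]
    have hy' : ‖y‖ ≠ 0 := norm_ne_zero_iff.mpr hy
    calc |radialQuadraticDeriv h ω p q v y|
        ≤ |ω ‖y‖| / ‖y‖ ^ 2 * (|inner ℝ y v| * (|p y| * |q y|)) +
          |h ‖y‖| * (|p v| * |q y| + |p y| * |q v|) := by
          refine (abs_add_le _ _).trans (add_le_add ?_ ?_)
          · simp [abs_mul, abs_div]
          · simpa only [abs_mul] using mul_le_mul_of_nonneg_left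
              (abs_add_le (p v * q y) (p y * q v)) (abs_nonneg (h ‖y‖))
      _ ≤ |ω ‖y‖| / ‖y‖ ^ 2 * ((‖y‖ * ‖v‖) * ((‖p‖ * ‖y‖) * (‖q‖ * ‖y‖))) +
          |h ‖y‖| * ((‖p‖ * ‖v‖) * (‖q‖ * ‖y‖) + (‖p‖ * ‖y‖) * (‖q‖ * ‖v‖)) := by
          gcongr
          · exact abs_real_inner_le_norm y v
          · exact p.le_opNorm y
          · exact q.le_opNorm y
          · exact p.le_opNorm v
          · exact q.le_opNorm y
          · exact p.le_opNorm y
          · exact q.le_opNorm v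
      _ = _ := by
          field_simp
          ring
  · simpa using (hω.abs.add (hh.abs.const_mul 2)).mul_const (‖v‖ * ‖p‖ * ‖q‖)

end RadialQuadratic

theorem ContinuousOn.tendsto_comp_norm_zero {R : ℝ} {E : Type*} [NormedAddCommGroup E] {g : ℝ → ℝ}
    (hg : ContinuousOn g (Icc 0 R)) (hR : 0 < R) (hg0 : g 0 = 0) :
    Tendsto (fun y : E => g ‖y‖) (𝓝 0) (𝓝 0) := by
  have h0 := hg 0 (left_mem_Icc.mpr hR.le)
  rw [ContinuousWithinAt, hg0] at h0
  refine h0.comp (tendsto_nhdsWithin_iff.mpr ⟨?_, ?_⟩)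
  · simpa using (continuous_norm (E := E)).tendsto 0
  · filter_upwards [Metric.ball_mem_nhds (0 : E) hR] with y hy
    exact ⟨norm_nonneg y, (mem_ball_zero_iff.mp hy).le⟩

theorem continuousOn_integral_div {ω : ℝ → ℝ} {R : ℝ} (hR : 0 < R)
    (hdini : IntegrableOn (fun s => ω s / s) (Ioc 0 R)) :
    ContinuousOn (fun r => ∫ s in (0:ℝ)..r, ω s / s) (Icc 0 R) := by
  have := intervalIntegral.continuousOn_primitive_interval (a := 0) (b := R)
    (f := fun s => ω s / s) (μ := volume)
    (by rwa [uIcc_of_le hR.le, integrableOn_Icc_iff_integrableOn_Ioc])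
  rwa [uIcc_of_le hR.le] at this

namespace IsOsc

variable {ω : ℝ → ℝ} {R : ℝ}

theorem hasDerivAt_integral_div (hω : IsOsc ω R)
    (hdini : IntegrableOn (fun s => ω s / s) (Ioc 0 R)) {r : ℝ} (hr : r ∈ Ioo 0 R) :
    HasDerivAt (fun r => ∫ s in (0:ℝ)..r, ω s / s) (ω r / r) r := by
  have hc : ContinuousOn (fun s => ω s / s) (Ioo 0 R) :=
    (hω.cont.mono Ioo_subset_Icc_self).div continuousOn_id fun s hs => hs.1.ne'
  refine intervalIntegral.integral_hasDerivAt_right ?_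
    (hc.stronglyMeasurableAtFilter isOpen_Ioo r hr) (hc.continuousAt (isOpen_Ioo.mem_nhds hr))
  rw [intervalIntegrable_iff_integrableOn_Ioc_of_le hr.1.le]
  exact hdini.mono_set (Ioc_subset_Ioc_right hr.2.le)

end IsOsc

section EuclideanSpace

variable {n : ℕ} {h ω : ℝ → ℝ} {u : EuclideanSpace ℝ (Fin n) → ℝ} {k l : Fin n} {δ : ℝ}

theorem pd2_radialQuadratic
    (hu : ∀ x, u x = h ‖x‖ * (x k * x l))
    (hh : ∀ r ∈ Ioo 0 δ, HasDerivAt h (ω r / r) r)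
    (hh0 : Tendsto (fun y : EuclideanSpace ℝ (Fin n) => h ‖y‖) (𝓝 0) (𝓝 0))
    (hω : ∀ r ∈ Ioo 0 δ, DifferentiableAt ℝ ω r) (i j : Fin n)
    {x : EuclideanSpace ℝ (Fin n)} (hx : x ≠ 0) (hxδ : ‖x‖ < δ) :
    pd2 u i j x =
      (deriv ω ‖x‖ / ‖x‖ ^ 3 - 2 * ω ‖x‖ / ‖x‖ ^ 4) * (x i * x j * (x k * x l)) +
        ω ‖x‖ / ‖x‖ ^ 2 * ((if i = j then 1 else 0) * (x k * x l) +
          x j * ((if k = i then 1 else 0) * x l + x k * (if l = i then 1 else 0)) +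
          x i * ((if k = j then 1 else 0) * x l + x k * (if l = j then 1 else 0))) +
        h ‖x‖ * ((if k = j then 1 else 0) * (if l = i then 1 else 0) +
          (if k = i then 1 else 0) * (if l = j then 1 else 0)) := by
  have hr : ‖x‖ ∈ Ioo 0 δ := ⟨norm_pos_iff.mpr hx, hxδ⟩
  obtain rfl : u = fun y => h ‖y‖ *
      (EuclideanSpace.proj (𝕜 := ℝ) k y * EuclideanSpace.proj (𝕜 := ℝ) l y) := funext hu
  rw [pd2, (eventuallyEq_fderiv_radialQuadratic hh hh0 _ hxδ).fderiv_eq,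
    fderiv_radialQuadraticDeriv hx (hh _ hr) (hω _ hr).hasDerivAt]
  simp [EuclideanSpace.inner_single_right, eq_comm]

theorem pd2_radialQuadratic_zero
    (hu : ∀ x, u x = h ‖x‖ * (x k * x l))
    (hh : ∀ r ∈ Ioo 0 δ, HasDerivAt h (ω r / r) r)
    (hh0 : Tendsto (fun y : EuclideanSpace ℝ (Fin n) => h ‖y‖) (𝓝 0) (𝓝 0))
    (hω0 : Tendsto (fun y : EuclideanSpace ℝ (Fin n) => ω ‖y‖) (𝓝 0) (𝓝 0))
    (hδ : 0 < δ) (i j : Fin n) :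
    pd2 u i j 0 = 0 := by
  obtain rfl : u = fun y => h ‖y‖ *
      (EuclideanSpace.proj (𝕜 := ℝ) k y * EuclideanSpace.proj (𝕜 := ℝ) l y) := funext hu
  rw [pd2, (eventuallyEq_fderiv_radialQuadratic hh hh0 _ (by simpa using hδ)).fderiv_eq,
    fderiv_radialQuadraticDeriv_zero hh0 hω0]
  simp

theorem sum_pd2_radialQuadratic (hkl : k ≠ l)
    (hu : ∀ x, u x = h ‖x‖ * (x k * x l))
    (hh : ∀ r ∈ Ioo 0 δ, HasDerivAt h (ω r / r) r)
    (hh0 : Tendsto (fun y : EuclideanSpace ℝ (Fin n) => h ‖y‖) (𝓝 0) (𝓝 0))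
    (hω : ∀ r ∈ Ioo 0 δ, DifferentiableAt ℝ ω r)
    {x : EuclideanSpace ℝ (Fin n)} (hx : x ≠ 0) (hxδ : ‖x‖ < δ) :
    ∑ i, pd2 u i i x =
      (n + 2) * (x k * x l / ‖x‖ ^ 2) * ω ‖x‖ +
        (x k * x l / ‖x‖ ^ 2) * (‖x‖ * deriv ω ‖x‖) := by
  have hx' : ‖x‖ ≠ 0 := norm_ne_zero_iff.mpr hx
  have hsq : ∑ i, x i * x i * (x k * x l) = ‖x‖ ^ 2 * (x k * x l) := by
    rw [← Finset.sum_mul, EuclideanSpace.real_norm_sq_eq]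
    simp only [sq]
  simp only [pd2_radialQuadratic hu hh hh0 hω _ _ hx hxδ, Finset.sum_add_distrib,
    ← Finset.mul_sum, hsq]
  simp [mul_add, Finset.sum_add_distrib, hkl]
  field_simp
  ring

theorem sq_add_sq_le_norm_sq (hkl : k ≠ l) (x : EuclideanSpace ℝ (Fin n)) :
    x k ^ 2 + x l ^ 2 ≤ ‖x‖ ^ 2 := by
  rw [EuclideanSpace.real_norm_sq_eq, ← Finset.sum_pair (f := fun i => x i ^ 2) hkl]
  exact Finset.sum_le_sum_of_subset_of_nonneg (Finset.subset_univ _) fun i _ _ => sq_nonneg _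

end EuclideanSpace

/-- Sharpness construction: for `u(x) = ĥ(|x|) x₁ x₂` with `ĥ(r) = ∫₀^r ω(s)/s ds`,
near the origin one has the explicit formulas for `Δu` and `∂₁∂₂u`, the bound
`|Δu(x) - Δu(0)| = |Δu(x)| ≤ C' ω(|x|)`, and the lower bound
`|∂₁∂₂u(x) - ∂₁∂₂u(0)| ≥ ĥ(|x|)`; hence any regularity statement `Δu ∈ D_ω ⟹ ∇²u ∈ D_{ĥ₀}`
near the origin forces `ĥ ≤ c ĥ₀` near `0`. -/
theorem sharpness_construction {n : ℕ} (hn : 2 ≤ n)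
    (R δ₁ : ℝ) (hR : 0 < R) (hδ₁ : 0 < δ₁) (hδ₁R : δ₁ ≤ R)
    (ω : ℝ → ℝ) (hω : IsOsc ω R)
    (hdiff : ∀ r ∈ Set.Ioo (0:ℝ) δ₁, DifferentiableAt ℝ ω r)
    (hdini : IntegrableOn (fun s => ω s / s) (Set.Ioc 0 R))
    (C : ℝ) (hC : 0 < C)
    (hratio : ∀ r ∈ Set.Ioo (0:ℝ) δ₁, C ≤ ω r / (r * deriv ω r))
    (u : EuclideanSpace ℝ (Fin n) → ℝ)
    (hu : ∀ x : EuclideanSpace ℝ (Fin n),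
      u x = (∫ s in (0:ℝ)..‖x‖, ω s / s) * (x ⟨0, by omega⟩ * x ⟨1, by omega⟩)) :
    ∃ δ C' : ℝ, 0 < δ ∧ 0 < C' ∧
      (∑ i, pd2 u i i) 0 = 0 ∧
      pd2 u ⟨0, by omega⟩ ⟨1, by omega⟩ 0 = 0 ∧
      (∀ x : EuclideanSpace ℝ (Fin n), x ≠ 0 → ‖x‖ < δ →
        ((∑ i, pd2 u i i) x =
            (n + 2) * (x ⟨0, by omega⟩ * x ⟨1, by omega⟩ / ‖x‖ ^ 2) * ω ‖x‖ +
              (x ⟨0, by omega⟩ * x ⟨1, by omega⟩ / ‖x‖ ^ 2) * (‖x‖ * deriv ω ‖x‖)) ∧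
          |(∑ i, pd2 u i i) x| ≤ C' * ω ‖x‖ ∧
          pd2 u ⟨0, by omega⟩ ⟨1, by omega⟩ x =
            (∫ s in (0:ℝ)..‖x‖, ω s / s) +
              (1 / ‖x‖ ^ 2) *
                ((x ⟨0, by omega⟩) ^ 2 + (x ⟨1, by omega⟩) ^ 2 -
                  2 * (x ⟨0, by omega⟩) ^ 2 * (x ⟨1, by omega⟩) ^ 2 / ‖x‖ ^ 2) * ω ‖x‖ +
              ((x ⟨0, by omega⟩) ^ 2 * (x ⟨1, by omega⟩) ^ 2 / ‖x‖ ^ 4) *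
                (‖x‖ * deriv ω ‖x‖) ∧
          (∫ s in (0:ℝ)..‖x‖, ω s / s) ≤
            |pd2 u ⟨0, by omega⟩ ⟨1, by omega⟩ x -
              pd2 u ⟨0, by omega⟩ ⟨1, by omega⟩ 0|) ∧
      (∀ (h₀ : ℝ → ℝ) (c' δ' : ℝ), 0 < c' → 0 < δ' →
        (∀ x y : EuclideanSpace ℝ (Fin n), ‖x‖ < δ' → ‖y‖ < δ' →
          |pd2 u ⟨0, by omega⟩ ⟨1, by omega⟩ x -
            pd2 u ⟨0, by omega⟩ ⟨1, by omega⟩ y| ≤ c' * h₀ ‖x - y‖) →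
        ∃ c δ'' : ℝ, 0 < c ∧ 0 < δ'' ∧
          ∀ r ∈ Set.Ioo (0:ℝ) δ'', (∫ s in (0:ℝ)..r, ω s / s) ≤ c * h₀ r) := by
  have hR' : Ioo 0 δ₁ ⊆ Ioo 0 R := Ioo_subset_Ioo_right hδ₁R
  have hkl : (⟨0, by omega⟩ : Fin n) ≠ ⟨1, by omega⟩ := by simp
  have hh := fun r (hr : r ∈ Ioo 0 δ₁) => hω.hasDerivAt_integral_div hdini (hR' hr)
  have hh0 : Tendsto (fun y : EuclideanSpace ℝ (Fin n) => ∫ s in (0:ℝ)..‖y‖, ω s / s)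
      (𝓝 0) (𝓝 0) :=
    (continuousOn_integral_div hR hdini).tendsto_comp_norm_zero hR (by simp)
  have hω0 : Tendsto (fun y : EuclideanSpace ℝ (Fin n) => ω ‖y‖) (𝓝 0) (𝓝 0) :=
    hω.cont.tendsto_comp_norm_zero hR hω.zero
  have hzero := fun i j => pd2_radialQuadratic_zero hu hh hh0 hω0 hδ₁ i j
  have hderiv : ∀ r ∈ Ioo 0 δ₁, 0 ≤ r * deriv ω r ∧ r * deriv ω r ≤ ω r / C := by
    intro r hr
    have hpos : 0 < ω r := hω.pos r hr.1 (hr.2.le.trans hδ₁R)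
    have hd : 0 < r * deriv ω r :=
      (div_pos_iff_of_pos_left hpos).mp (hC.trans_le (hratio r hr))
    refine ⟨hd.le, ?_⟩
    rw [le_div_iff₀ hC, mul_comm]
    exact (le_div_iff₀ hd).mp (hratio r hr)
  have hmixed : ∀ x : EuclideanSpace ℝ (Fin n), x ≠ 0 → ‖x‖ < δ₁ →
      pd2 u ⟨0, by omega⟩ ⟨1, by omega⟩ x =
        (∫ s in (0:ℝ)..‖x‖, ω s / s) +
          (1 / ‖x‖ ^ 2) *
            ((x ⟨0, by omega⟩) ^ 2 + (x ⟨1, by omega⟩) ^ 2 -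
              2 * (x ⟨0, by omega⟩) ^ 2 * (x ⟨1, by omega⟩) ^ 2 / ‖x‖ ^ 2) * ω ‖x‖ +
          ((x ⟨0, by omega⟩) ^ 2 * (x ⟨1, by omega⟩) ^ 2 / ‖x‖ ^ 4) *
            (‖x‖ * deriv ω ‖x‖) := by
    intro x hx hxδ
    have hx' : ‖x‖ ≠ 0 := norm_ne_zero_iff.mpr hx
    rw [pd2_radialQuadratic hu hh hh0 hdiff _ _ hx hxδ]
    simp only [if_neg hkl, if_neg hkl.symm, if_true]
    field_simp
    ring
  have hlower : ∀ x : EuclideanSpace ℝ (Fin n), x ≠ 0 → ‖x‖ < δ₁ →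
      (∫ s in (0:ℝ)..‖x‖, ω s / s) ≤
        |pd2 u ⟨0, by omega⟩ ⟨1, by omega⟩ x - pd2 u ⟨0, by omega⟩ ⟨1, by omega⟩ 0| := by
    intro x hx hxδ
    have hr : 0 < ‖x‖ := norm_pos_iff.mpr hx
    have hab := sq_add_sq_le_norm_sq hkl x
    rw [hzero, sub_zero]
    refine le_trans ?_ (le_abs_self _)
    rw [hmixed x hx hxδ, add_assoc]
    refine le_add_of_nonneg_right (add_nonneg (mul_nonneg (mul_nonneg (by positivity) ?_)
      (hω.pos _ hr (hxδ.le.trans hδ₁R)).le) (mul_nonneg (by positivity) (hderiv _ ⟨hr, hxδ⟩).1))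
    rw [sub_nonneg, div_le_iff₀ (by positivity)]
    generalize x ⟨0, _⟩ = a at *
    generalize x ⟨1, _⟩ = b at *
    nlinarith [mul_le_mul_of_nonneg_left hab (by positivity : 0 ≤ a ^ 2 + b ^ 2),
      sq_nonneg (a ^ 2), sq_nonneg (b ^ 2)]
  refine ⟨δ₁, n + 2 + 1 / C, hδ₁, by positivity, by simp [hzero], hzero _ _, ?_, ?_⟩
  · intro x hx hxδ
    have hr : 0 < ‖x‖ := norm_pos_iff.mpr hx
    have hlap := sum_pd2_radialQuadratic hkl hu hh hh0 hdiff hx hxδ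
    rw [← Finset.sum_apply] at hlap
    refine ⟨hlap, ?_, hmixed x hx hxδ, hlower x hx hxδ⟩
    have hab := sq_add_sq_le_norm_sq hkl x
    have hpos := hω.pos _ hr (hxδ.le.trans hδ₁R)
    obtain ⟨hd0, hd⟩ := hderiv _ ⟨hr, hxδ⟩
    rw [hlap]
    have hq : |x ⟨0, by omega⟩ * x ⟨1, by omega⟩ / ‖x‖ ^ 2| ≤ 1 := by
      rw [abs_div, abs_of_pos (pow_pos hr 2), div_le_one (pow_pos hr 2), abs_le]
      constructor <;> nlinarith [sq_nonneg (x ⟨0, by omega⟩ + x ⟨1, by omega⟩),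
        sq_nonneg (x ⟨0, by omega⟩ - x ⟨1, by omega⟩)]
    calc _ = |x ⟨0, by omega⟩ * x ⟨1, by omega⟩ / ‖x‖ ^ 2| *
          ((n + 2) * ω ‖x‖ + ‖x‖ * deriv ω ‖x‖) := by
          have hsum : 0 ≤ (n + 2) * ω ‖x‖ + ‖x‖ * deriv ω ‖x‖ := by positivity
          rw [← abs_of_nonneg hsum, ← abs_mul]
          congr 1
          ring
      _ ≤ 1 * ((n + 2) * ω ‖x‖ + ω ‖x‖ / C) := by gcongr
      _ = (n + 2 + 1 / C) * ω ‖x‖ := by ring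
  · intro h₀ c' δ' hc' hδ' hreg
    refine ⟨c', min δ₁ δ', hc', lt_min hδ₁ hδ', fun r hr => ?_⟩
    have hnorm : ‖(EuclideanSpace.single ⟨0, by omega⟩ r : EuclideanSpace ℝ (Fin n))‖ = r := by
      rw [PiLp.norm_single, Real.norm_of_nonneg hr.1.le]
    have hne : (EuclideanSpace.single ⟨0, by omega⟩ r : EuclideanSpace ℝ (Fin n)) ≠ 0 :=
      norm_pos_iff.mp (hnorm.symm ▸ hr.1)
    have h1 := hlower _ hne (hnorm.symm ▸ hr.2.trans_le (min_le_left _ _))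
    have h2 := hreg (EuclideanSpace.single ⟨0, by omega⟩ r) 0
      (hnorm.symm ▸ hr.2.trans_le (min_le_right _ _)) (by simpa using hδ')
    rw [hnorm] at h1
    rw [sub_zero, hnorm] at h2
    exact h1.trans h2
end
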